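/- arXiv:1703.04668 — 2 statements merged into one kernel-verified Lean document; each statement's English description precedes it below -/
import Mathlib

section
/- If P : ℂ → ℂ is a computable polynomial of degree ≥ 2 whose filled Julia set K(P) has empty interior, then J(P) = K(P) and the Julia set J(P) is a computable compact set. -/
open Complex Metric Set Filter Polynomial

noncomputable section

/-- `x` is a computable real number. -/
def ComputableReal (x : ℝ) : Prop :=
  ∃ g : ℕ → ℚ, Computable g ∧ ∀ n : ℕ, |(g n : ℝ) - x| < (1 / 2) ^ n

/-- `z` is a computable complex number. -/
def ComputableComplex (z : ℂ) : Prop :=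
  ComputableReal z.re ∧ ComputableReal z.im

/-- The point of `ℂ` with rational coordinates `q`. -/
def ratPoint (q : ℚ × ℚ) : ℂ := ⟨(q.1 : ℝ), (q.2 : ℝ)⟩

/-- The rational ball coded by the triple `c` (center coordinates, radius). -/
def ratBall (c : ℚ × ℚ × ℚ) : Set ℂ := Metric.ball (ratPoint (c.1, c.2.1)) (c.2.2 : ℝ)

/-- A computable enumeration of (codes of) rational balls. -/
def ballEnum (n : ℕ) : ℚ × ℚ × ℚ := Denumerable.ofNat (ℚ × ℚ × ℚ) n

/-- `U` is a lower computable (recursively enumerable) open subset of `ℂ`: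
it is a union of a computable sequence of rational balls. -/
def LowerComputableOpen (U : Set ℂ) : Prop :=
  ∃ g : ℕ → ℚ × ℚ × ℚ, Computable g ∧ U = ⋃ n, ratBall (g n)

/-- `K` is a computable (compact) subset of `ℂ`: there is a computable assignment of a
finite list of rational points to each `n`, within Hausdorff distance `2⁻ⁿ` of `K`. -/
def ComputableCompactSet (K : Set ℂ) : Prop :=
  ∃ C : ℕ → List (ℚ × ℚ), Computable C ∧
    ∀ n : ℕ, (C n = [] ↔ K = ∅) ∧
      Metric.hausdorffDist (ratPoint '' {q | q ∈ C n}) K < (1 / 2) ^ n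

/-- `x` is a uniformly computable sequence of complex numbers. -/
def UniformlyComputableSeq (x : ℕ → ℂ) : Prop :=
  ∃ h : ℕ × ℕ → ℚ × ℚ, Computable h ∧
    ∀ n m : ℕ, dist (ratPoint (h (n, m))) (x n) ≤ (1 / 2) ^ m

/-- A compact set `K` is lower computable if some uniformly computable sequence of
points of `K` is dense in `K`. -/
def LowerComputableCompact (K : Set ℂ) : Prop :=
  ∃ x : ℕ → ℂ, (∀ n, x n ∈ K) ∧ UniformlyComputableSeq x ∧ K ⊆ closure (Set.range x)

/-- `f` is computable on `S`: preimages of rational balls are, relative to `S`,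
uniformly lower computable open sets. -/
def ComputableOn (f : ℂ → ℂ) (S : Set ℂ) : Prop :=
  ∃ e : ℕ × ℕ → ℚ × ℚ × ℚ, Computable e ∧
    ∀ n : ℕ, f ⁻¹' ratBall (ballEnum n) ∩ S = (⋃ k, ratBall (e (n, k))) ∩ S

/-- The filled Julia set of `f`: points with bounded forward orbit. -/
def filledJulia (f : ℂ → ℂ) : Set ℂ :=
  {z : ℂ | Bornology.IsBounded (Set.range fun n : ℕ => f^[n] z)}

/-- The Julia set of `f`: the boundary of the filled Julia set. -/
def juliaSet (f : ℂ → ℂ) : Set ℂ := frontier (filledJulia f)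

/-- The external ray of angle `t` (traced by `r ↦ φ (r e^{2πit})`, `r > 1`) lands at `w`. -/
def Lands (φ : ℂ → ℂ) (t : ℝ) (w : ℂ) : Prop :=
  Filter.Tendsto (fun r : ℝ => φ ((r : ℂ) * Complex.exp (2 * Real.pi * Complex.I * (t : ℂ))))
    (nhdsWithin 1 (Set.Ioi 1)) (nhds w)

/-! ### Part A: computability of rational arithmetic -/

section PartA

variable {α β : Type*} [Primcodable α] [Primcodable β]

theorem exists_computable_search (p : α → ℕ → Bool) (hp : Computable₂ p)
    (h : ∀ a, ∃ n, p a n = true) :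
    ∃ f : α → ℕ, Computable f ∧ ∀ a, p a (f a) = true := by
  classical
  refine ⟨fun a => Nat.find (h a), ?_, fun a => Nat.find_spec (h a)⟩
  have hp' : Partrec₂ (fun a n => (Part.some (p a n) : Part Bool)) := hp.partrec₂
  refine (Partrec.rfind hp').of_eq_tot ?_
  intro a
  refine Nat.mem_rfind.2 ⟨by simpa using Nat.find_spec (h a), ?_⟩
  intro m hm
  have := Nat.find_min (h a) hm
  simpa using this

theorem exists_computable_choose [Inhabited β] (p : α → β → Bool) (hp : Computable₂ p)
    (h : ∀ a, ∃ n, p a n = true) :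
    ∃ f : α → β, Computable f ∧ ∀ a, p a (f a) = true := by
  obtain ⟨f, hf, hf'⟩ := exists_computable_search
    (fun (a : α) (n : ℕ) => ((Encodable.decode (α := β) n).map (p a)).getD false) (by
      apply Computable₂.mk
      refine Computable.option_getD (Computable.option_map ?_ ?_) (Computable.const false)
      · exact Computable.decode.comp Computable.snd
      · apply Computable₂.mk
        exact hp.comp (Computable.fst.comp Computable.fst) Computable.snd)
    (fun a => by
      obtain ⟨b, hb⟩ := h a
      exact ⟨Encodable.encode b, by simp [hb]⟩)
  refine ⟨fun a => (Encodable.decode (α := β) (f a)).getD default,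
    Computable.option_getD (Computable.decode.comp hf) (Computable.const default), fun a => ?_⟩
  have := hf' a
  rcases hd : Encodable.decode (α := β) (f a) with _ | b
  · simp [hd] at this
  · simpa [hd] using this

theorem cNatAdd {f g : α → ℕ} (hf : Computable f) (hg : Computable g) :
    Computable fun a => f a + g a := (Primrec.nat_add.to_comp).comp hf hg

theorem cNatMul {f g : α → ℕ} (hf : Computable f) (hg : Computable g) :
    Computable fun a => f a * g a := (Primrec.nat_mul.to_comp).comp hf hg

theorem cNatEq {f g : α → ℕ} (hf : Computable f) (hg : Computable g) :
    Computable fun a => decide (f a = g a) :=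
  (Primrec.eq.decide.to_comp : Computable₂ fun a b : ℕ => decide (a = b)).comp hf hg

theorem cNatLe {f g : α → ℕ} (hf : Computable f) (hg : Computable g) :
    Computable fun a => decide (f a ≤ g a) :=
  (Primrec.nat_le.decide.to_comp : Computable₂ fun a b : ℕ => decide (a ≤ b)).comp hf hg

theorem cAnd {f g : α → Bool} (hf : Computable f) (hg : Computable g) :
    Computable fun a => (f a && g a) := (Primrec.and.to_comp).comp hf hg

theorem cOr {f g : α → Bool} (hf : Computable f) (hg : Computable g) :
    Computable fun a => (f a || g a) := (Primrec.or.to_comp).comp hf hg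

theorem cNot {f : α → Bool} (hf : Computable f) :
    Computable fun a => !(f a) := (Primrec.not.to_comp).comp hf

/-- Bounded universal quantification over naturals. -/
def allLt (p : ℕ → Bool) (n : ℕ) : Bool := Nat.rec true (fun i b => b && p i) n

theorem allLt_iff (p : ℕ → Bool) (n : ℕ) : allLt p n = true ↔ ∀ i < n, p i = true := by
  induction n with
  | zero => simp [allLt]
  | succ n ih =>
    have : allLt p (n+1) = (allLt p n && p n) := rfl
    rw [this, Bool.and_eq_true, ih]
    constructor
    · rintro ⟨h1, h2⟩ i hi
      rcases Nat.lt_succ_iff_lt_or_eq.1 hi with h | rfl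
      · exact h1 i h
      · exact h2
    · intro h
      exact ⟨fun i hi => h i (by omega), h n (by omega)⟩

theorem cAllLt {f : α → ℕ} {p : α → ℕ → Bool} (hf : Computable f) (hp : Computable₂ p) :
    Computable fun a => allLt (p a) (f a) := by
  have h : Computable₂ (fun (a : α) (ib : ℕ × Bool) => (ib.2 && p a ib.1)) := by
    apply Computable₂.mk
    exact cAnd (Computable.snd.comp Computable.snd)
      (hp.comp Computable.fst (Computable.fst.comp Computable.snd))
  exact Computable.nat_rec hf (Computable.const true) h

/-- Membership in a list bounded by a computable test. -/
theorem cListAll {l : α → List β} {p : α → β → Bool} (hl : Computable l) (hp : Computable₂ p) :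
    Computable fun a => (l a).all (p a) := by
  have h : Computable₂ (fun (a : α) (i : ℕ) => (((l a)[i]?).map (p a)).getD true) := by
    apply Computable₂.mk
    refine Computable.option_getD (Computable.option_map ?_ ?_) (Computable.const true)
    · exact Computable.list_getElem?.comp (hl.comp Computable.fst) Computable.snd
    · apply Computable₂.mk
      exact hp.comp (Computable.fst.comp Computable.fst) Computable.snd
  refine (cAllLt (Computable.list_length.comp hl) h).of_eq ?_
  intro a
  rw [Bool.eq_iff_iff, allLt_iff, List.all_eq_true]
  constructor
  · intro H x hx
    obtain ⟨i, hi, rfl⟩ := List.mem_iff_getElem.1 hx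
    have := H i hi
    simpa [hi] using this
  · intro H i hi
    have hi' : i < (l a).length := hi
    simpa [hi'] using H _ (List.getElem_mem hi')

/-- The raw code of a rational. -/
def rawCode (q : ℚ) : ℕ := Nat.pair (Equiv.intEquivNat q.num) q.den

/-- natAbs of the integer with code `e`. -/
def codeAbs (e : ℕ) : ℕ := Nat.div2 e + (bif Nat.bodd e then 1 else 0)

/-- Decision procedure for the range of `rawCode`. -/
def inRaw (x : ℕ) : Bool :=
  (decide (1 ≤ x.unpair.2)) && allLt (fun i => !(decide ((codeAbs x.unpair.1) % (i+2) = 0) &&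
    decide (x.unpair.2 % (i+2) = 0))) x.unpair.2

theorem codeAbs_eq (z : ℤ) : codeAbs (Equiv.intEquivNat z) = z.natAbs := by
  cases z with
  | ofNat x =>
    have : Equiv.intEquivNat (Int.ofNat x) = 2*x := rfl
    rw [this]; simp [codeAbs, Nat.div2_val]
  | negSucc x =>
    have : Equiv.intEquivNat (Int.negSucc x) = 2*x+1 := rfl
    rw [this]; simp [codeAbs, Nat.div2_val]

theorem cCodeAbs : Computable codeAbs :=
  cNatAdd Computable.nat_div2 (Computable.cond Computable.nat_bodd (Computable.const 1)
    (Computable.const 0))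

theorem cInRaw : Computable inRaw := by
  have hu1 : Computable fun x : ℕ => x.unpair.1 := Computable.fst.comp Computable.unpair
  have hu2 : Computable fun x : ℕ => x.unpair.2 := Computable.snd.comp Computable.unpair
  refine cAnd (cNatLe (Computable.const 1) hu2) (cAllLt hu2 ?_)
  apply Computable₂.mk
  have hi : Computable fun p : ℕ × ℕ => p.2 + 2 := cNatAdd Computable.snd (Computable.const 2)
  have hm : Computable₂ fun a b : ℕ => a % b := Primrec.nat_mod.to_comp
  refine cNot (cAnd (cNatEq ?_ (Computable.const 0)) (cNatEq ?_ (Computable.const 0)))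
  · exact hm.comp (cCodeAbs.comp (hu1.comp Computable.fst)) hi
  · exact hm.comp (hu2.comp Computable.fst) hi

theorem inRaw_iff (x : ℕ) : inRaw x = true ↔ x ∈ Set.range rawCode := by
  have key : inRaw x = true ↔ 1 ≤ x.unpair.2 ∧ Nat.Coprime (codeAbs x.unpair.1) x.unpair.2 := by
    rw [inRaw, Bool.and_eq_true, allLt_iff, decide_eq_true_iff]
    refine and_congr_right fun h1 => ?_
    constructor
    · intro H
      rw [Nat.coprime_iff_gcd_eq_one] 
      by_contra hne
      set g := Nat.gcd (codeAbs x.unpair.1) x.unpair.2 with hg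
      have hg0 : 0 < g := Nat.gcd_pos_of_pos_right _ h1
      have hga : g ∣ codeAbs x.unpair.1 := Nat.gcd_dvd_left _ _
      have hgb : g ∣ x.unpair.2 := Nat.gcd_dvd_right _ _
      have hle : g ≤ x.unpair.2 := Nat.le_of_dvd h1 hgb
      have := H (g - 2) (by omega)
      rw [show g - 2 + 2 = g by omega] at this
      simp [Nat.mod_eq_zero_of_dvd hga, Nat.mod_eq_zero_of_dvd hgb] at this
    · intro H i hi
      by_contra hne
      simp only [Bool.not_eq_true', Bool.not_eq_false, Bool.and_eq_true, decide_eq_true_iff] at hne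
      have := Nat.dvd_gcd (Nat.dvd_of_mod_eq_zero hne.1) (Nat.dvd_of_mod_eq_zero hne.2)
      rw [Nat.coprime_iff_gcd_eq_one.1 H] at this
      have := Nat.le_of_dvd one_pos this
      omega
  rw [key]
  constructor
  · rintro ⟨h1, h2⟩
    have hz := codeAbs_eq (Equiv.intEquivNat.symm x.unpair.1)
    rw [Equiv.apply_symm_apply] at hz
    refine ⟨⟨Equiv.intEquivNat.symm x.unpair.1, x.unpair.2, by omega, by rw [← hz]; exact h2⟩, ?_⟩
    simp [rawCode]
  · rintro ⟨q, rfl⟩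
    simp only [rawCode, Nat.unpair_pair, codeAbs_eq]
    exact ⟨q.den_pos, q.reduced⟩

theorem rawCode_injective : Function.Injective rawCode := by
  intro p q h
  simp only [rawCode, Nat.pair_eq_pair] at h
  exact Rat.ext (Equiv.intEquivNat.injective h.1) h.2

/-- Number of raw codes below `x`. -/
def rawCount (x : ℕ) : ℕ := Nat.rec 0 (fun i b => b + (bif inRaw i then 1 else 0)) x

theorem rawCount_succ (x : ℕ) : rawCount (x+1) = rawCount x + (bif inRaw x then 1 else 0) := rfl

/-- The code of a rational used by `Computable`. -/
def ratCode (q : ℚ) : ℕ := @Encodable.encode ℚ Primcodable.toEncodable q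

theorem cRatCode : Computable ratCode := Computable.encode

theorem rat_encode_eq (q : ℚ) : ratCode q = rawCount (rawCode q) := by
  have h1 : ratCode q = (List.range (rawCode q)).countP
      (fun x => @decide (x ∈ Set.range (@Encodable.encode ℚ Rat.instEncodable))
        (Encodable.decidableRangeEncode ℚ x)) := rfl
  rw [h1]
  generalize rawCode q = n
  induction n with
  | zero => rfl
  | succ n ih =>
    rw [List.range_succ, List.countP_append, ih, rawCount_succ]
    congr 1
    have h2 : inRaw n = true ↔ n ∈ Set.range (@Encodable.encode ℚ Rat.instEncodable) := inRaw_iff n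
    by_cases h : inRaw n = true
    · simp only [List.countP_cons, List.countP_nil, decide_eq_true_eq, ← h2, h]; rfl
    · simp only [List.countP_cons, List.countP_nil, decide_eq_true_eq, ← h2, h]
      simp at h; simp

theorem cRawCount : Computable rawCount := by
  refine Computable.nat_rec (f := fun x : ℕ => x) (g := fun _ => 0)
    (h := fun _ ib => ib.2 + (bif inRaw ib.1 then 1 else 0)) Computable.id (Computable.const 0) ?_
  apply Computable₂.mk
  exact cNatAdd (Computable.snd.comp Computable.snd) (Computable.cond
    (cInRaw.comp (Computable.fst.comp Computable.snd)) (Computable.const 1) (Computable.const 0))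

theorem rawCount_mono : Monotone rawCount :=
  monotone_nat_of_le_succ fun n => by rw [rawCount_succ]; omega

theorem rawCount_inj {x y : ℕ} (hx : inRaw x = true) (hy : inRaw y = true)
    (h : rawCount x = rawCount y) : x = y := by
  wlog hxy : x < y generalizing x y
  · rcases lt_trichotomy x y with h' | h' | h'
    · exact this hx hy h h'
    · exact h'
    · exact (this hy hx h.symm h').symm
  have := rawCount_mono (Nat.succ_le_of_lt hxy)
  rw [Nat.succ_eq_add_one, rawCount_succ, hx] at this
  simp at this
  omega

theorem cRawCode : Computable rawCode := by
  obtain ⟨f, hf, hf'⟩ := exists_computable_search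
    (fun (q : ℚ) (x : ℕ) => inRaw x && decide (rawCount x = ratCode q)) (by
      apply Computable₂.mk
      exact cAnd (cInRaw.comp Computable.snd)
        (cNatEq (cRawCount.comp Computable.snd) (cRatCode.comp Computable.fst)))
    (fun q => ⟨rawCode q, by simp [rat_encode_eq, (inRaw_iff _).2 ⟨q, rfl⟩]⟩)
  refine hf.of_eq fun q => ?_
  have := hf' q
  simp only [Bool.and_eq_true, decide_eq_true_iff] at this
  exact rawCount_inj this.1 ((inRaw_iff _).2 ⟨q, rfl⟩) (by rw [this.2, rat_encode_eq])

/-- positive part of the numerator -/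
def ratPos (q : ℚ) : ℕ := q.num.toNat
/-- negative part of the numerator -/
def ratNeg (q : ℚ) : ℕ := (-q.num).toNat

theorem cRatDen : Computable fun q : ℚ => q.den := by
  refine (Computable.snd.comp (Computable.unpair.comp cRawCode)).of_eq fun q => ?_
  simp [rawCode]

theorem cRatPos : Computable ratPos := by
  have h : Computable fun q : ℚ => (rawCode q).unpair.1 :=
    Computable.fst.comp (Computable.unpair.comp cRawCode)
  refine (Computable.cond (Computable.nat_bodd.comp h) (Computable.const 0)
    (Computable.nat_div2.comp h)).of_eq fun q => ?_
  simp only [rawCode, Nat.unpair_pair, ratPos]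
  generalize q.num = z
  cases z with
  | ofNat x =>
    have : Equiv.intEquivNat (Int.ofNat x) = 2*x := rfl
    rw [this]; simp [Nat.div2_val]
  | negSucc x =>
    have : Equiv.intEquivNat (Int.negSucc x) = 2*x+1 := rfl
    rw [this]; simp 

theorem cRatNeg : Computable ratNeg := by
  have h : Computable fun q : ℚ => (rawCode q).unpair.1 :=
    Computable.fst.comp (Computable.unpair.comp cRawCode)
  refine (Computable.cond (Computable.nat_bodd.comp h)
    (cNatAdd (Computable.nat_div2.comp h) (Computable.const 1)) (Computable.const 0)).of_eq
    fun q => ?_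
  simp only [rawCode, Nat.unpair_pair, ratNeg]
  generalize q.num = z
  cases z with
  | ofNat x =>
    have : Equiv.intEquivNat (Int.ofNat x) = 2*x := rfl
    rw [this]; simp 
  | negSucc x =>
    have : Equiv.intEquivNat (Int.negSucc x) = 2*x+1 := rfl
    rw [this]; simp [Nat.div2_val]

theorem rat_eq_parts (q : ℚ) : q = ((ratPos q : ℚ) - (ratNeg q : ℚ)) / (q.den : ℚ) := by
  have h : ((ratPos q : ℤ) - (ratNeg q : ℤ)) = q.num := by
    simp only [ratPos, ratNeg]; omega
  have h' : ((ratPos q : ℚ) - (ratNeg q : ℚ)) = (q.num : ℚ) := by exact_mod_cast h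
  rw [h', Rat.num_div_den]

theorem cRatLe2 : Computable₂ fun p q : ℚ => decide (p ≤ q) := by
  apply Computable₂.mk
  have h1 := (Computable.fst (α := ℚ) (β := ℚ))
  have h2 := (Computable.snd (α := ℚ) (β := ℚ))
  refine (cNatLe (cNatAdd (cNatMul (cRatPos.comp h1) (cRatDen.comp h2))
      (cNatMul (cRatNeg.comp h2) (cRatDen.comp h1)))
    (cNatAdd (cNatMul (cRatPos.comp h2) (cRatDen.comp h1))
      (cNatMul (cRatNeg.comp h1) (cRatDen.comp h2)))).of_eq ?_
  rintro ⟨p, q⟩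
  rw [decide_eq_decide]
  simp only
  have hp := rat_eq_parts p
  have hq := rat_eq_parts q
  have hpd : (0:ℚ) < p.den := by exact_mod_cast p.den_pos
  have hqd : (0:ℚ) < q.den := by exact_mod_cast q.den_pos
  conv_rhs => rw [hp, hq, div_le_div_iff₀ hpd hqd]
  rw [← @Nat.cast_le ℚ]
  push_cast
  constructor <;> intro h <;> linarith

theorem cRatLe {f g : α → ℚ} (hf : Computable f) (hg : Computable g) :
    Computable fun a => decide (f a ≤ g a) := cRatLe2.comp hf hg

theorem cRatSearch (F : α → ℚ) (p : α → ℚ → Bool) (hp : Computable₂ p)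
    (h : ∀ a q, p a q = true ↔ q = F a) : Computable F := by
  obtain ⟨f, hf, hf'⟩ := exists_computable_choose p hp (fun a => ⟨F a, (h a _).2 rfl⟩)
  exact hf.of_eq fun a => (h _ _).1 (hf' a)

theorem cRatAdd2 : Computable₂ fun p q : ℚ => p + q := by
  apply Computable₂.mk
  refine cRatSearch _ (fun (a : ℚ × ℚ) (q : ℚ) => decide
    (ratPos q * (a.1.den * a.2.den) + (ratNeg a.1 * (a.2.den * q.den) + ratNeg a.2 * (a.1.den * q.den))
    = ratNeg q * (a.1.den * a.2.den) + (ratPos a.1 * (a.2.den * q.den) + ratPos a.2 * (a.1.den * q.den))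
      )) ?_ ?_
  · apply Computable₂.mk
    have h1 : Computable fun x : (ℚ × ℚ) × ℚ => x.1.1 := Computable.fst.comp Computable.fst
    have h2 : Computable fun x : (ℚ × ℚ) × ℚ => x.1.2 := Computable.snd.comp Computable.fst
    have h3 : Computable fun x : (ℚ × ℚ) × ℚ => x.2 := Computable.snd
    have d1 := cRatDen.comp h1
    have d2 := cRatDen.comp h2
    have d3 := cRatDen.comp h3
    exact cNatEq (cNatAdd (cNatMul (cRatPos.comp h3) (cNatMul d1 d2))
      (cNatAdd (cNatMul (cRatNeg.comp h1) (cNatMul d2 d3)) (cNatMul (cRatNeg.comp h2) (cNatMul d1 d3))))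
      (cNatAdd (cNatMul (cRatNeg.comp h3) (cNatMul d1 d2))
      (cNatAdd (cNatMul (cRatPos.comp h1) (cNatMul d2 d3)) (cNatMul (cRatPos.comp h2) (cNatMul d1 d3))))
  · rintro ⟨a, b⟩ q
    rw [decide_eq_true_iff]
    simp only
    have ha : (a.den : ℚ) ≠ 0 := by exact_mod_cast a.den_nz
    have hb : (b.den : ℚ) ≠ 0 := by exact_mod_cast b.den_nz
    have hq : (q.den : ℚ) ≠ 0 := by exact_mod_cast q.den_nz
    conv_rhs => rw [rat_eq_parts a, rat_eq_parts b, rat_eq_parts q,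
      div_add_div _ _ ha hb, div_eq_div_iff hq (mul_ne_zero ha hb)]
    rw [← @Nat.cast_inj ℚ]
    push_cast
    constructor <;> intro h <;> linarith

theorem cRatMul2 : Computable₂ fun p q : ℚ => p * q := by
  apply Computable₂.mk
  refine cRatSearch _ (fun (a : ℚ × ℚ) (q : ℚ) => decide
    (ratPos q * (a.1.den * a.2.den) + (ratPos a.1 * ratNeg a.2 + ratNeg a.1 * ratPos a.2) * q.den
    = ratNeg q * (a.1.den * a.2.den) + (ratPos a.1 * ratPos a.2 + ratNeg a.1 * ratNeg a.2) * q.den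
      )) ?_ ?_
  · apply Computable₂.mk
    have h1 : Computable fun x : (ℚ × ℚ) × ℚ => x.1.1 := Computable.fst.comp Computable.fst
    have h2 : Computable fun x : (ℚ × ℚ) × ℚ => x.1.2 := Computable.snd.comp Computable.fst
    have h3 : Computable fun x : (ℚ × ℚ) × ℚ => x.2 := Computable.snd
    have d1 := cRatDen.comp h1
    have d2 := cRatDen.comp h2
    have d3 := cRatDen.comp h3
    exact cNatEq (cNatAdd (cNatMul (cRatPos.comp h3) (cNatMul d1 d2))
      (cNatMul (cNatAdd (cNatMul (cRatPos.comp h1) (cRatNeg.comp h2))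
        (cNatMul (cRatNeg.comp h1) (cRatPos.comp h2))) d3))
      (cNatAdd (cNatMul (cRatNeg.comp h3) (cNatMul d1 d2))
      (cNatMul (cNatAdd (cNatMul (cRatPos.comp h1) (cRatPos.comp h2))
        (cNatMul (cRatNeg.comp h1) (cRatNeg.comp h2))) d3))
  · rintro ⟨a, b⟩ q
    rw [decide_eq_true_iff]
    simp only
    have ha : (a.den : ℚ) ≠ 0 := by exact_mod_cast a.den_nz
    have hb : (b.den : ℚ) ≠ 0 := by exact_mod_cast b.den_nz
    have hq : (q.den : ℚ) ≠ 0 := by exact_mod_cast q.den_nz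
    conv_rhs => rw [rat_eq_parts a, rat_eq_parts b, rat_eq_parts q,
      div_mul_div_comm, div_eq_div_iff hq (mul_ne_zero ha hb)]
    rw [← @Nat.cast_inj ℚ]
    push_cast
    constructor <;> intro h <;> linarith

theorem cRatAdd {f g : α → ℚ} (hf : Computable f) (hg : Computable g) :
    Computable fun a => f a + g a := cRatAdd2.comp hf hg

theorem cRatMul {f g : α → ℚ} (hf : Computable f) (hg : Computable g) :
    Computable fun a => f a * g a := cRatMul2.comp hf hg

theorem cRatSub {f g : α → ℚ} (hf : Computable f) (hg : Computable g) :
    Computable fun a => f a - g a :=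
  (cRatAdd hf (cRatMul (Computable.const (-1)) hg)).of_eq fun a => by ring

theorem cRatPow (b : ℚ) {f : α → ℕ} (hf : Computable f) : Computable fun a => b ^ f a := by
  have : Computable fun n : ℕ => b ^ n := by
    refine (Computable.nat_rec (f := fun x : ℕ => x) (g := fun _ => (1 : ℚ))
      (h := fun _ ib => ib.2 * b) Computable.id (Computable.const 1) ?_).of_eq ?_
    · apply Computable₂.mk
      exact cRatMul (Computable.snd.comp Computable.snd) (Computable.const b)
    · intro n
      induction n with
      | zero => simp
      | succ n ih => simp only [pow_succ, ← ih]
  exact this.comp hf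

theorem cNatPow (b : ℕ) {f : α → ℕ} (hf : Computable f) : Computable fun a => b ^ f a := by
  have : Computable fun n : ℕ => b ^ n := by
    refine (Computable.nat_rec (f := fun x : ℕ => x) (g := fun _ => (1 : ℕ))
      (h := fun _ ib => ib.2 * b) Computable.id (Computable.const 1) ?_).of_eq ?_
    · apply Computable₂.mk
      exact cNatMul (Computable.snd.comp Computable.snd) (Computable.const b)
    · intro n
      induction n with
      | zero => simp
      | succ n ih => simp only [pow_succ, ← ih]
  exact this.comp hf

theorem cRatCast {f : α → ℕ} (hf : Computable f) : Computable fun a => (f a : ℚ) := by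
  have : Computable fun n : ℕ => (n : ℚ) := by
    refine (Computable.nat_rec (f := fun x : ℕ => x) (g := fun _ => (0 : ℚ))
      (h := fun _ ib => ib.2 + 1) Computable.id (Computable.const 0) ?_).of_eq ?_
    · apply Computable₂.mk
      exact cRatAdd (Computable.snd.comp Computable.snd) (Computable.const 1)
    · intro n
      induction n with
      | zero => simp
      | succ n ih => simp only [Nat.cast_succ, ← ih]
  exact this.comp hf

end PartA
/-! ### Part B: dynamics -/

section PartB

theorem norm_eval_eq_prod (Q : Polynomial ℂ) (z : ℂ) :
    ‖Q.eval z‖ = ‖Q.leadingCoeff‖ * (Q.roots.map fun r => ‖z - r‖).prod := by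
  rw [(IsAlgClosed.splits Q).eval_eq_prod_roots z, norm_mul]
  congr 1
  induction Q.roots using Multiset.induction_on with
  | empty => simp
  | cons a s ih => simp [ih]

theorem card_roots_eq (Q : Polynomial ℂ) : Q.roots.card = Q.natDegree :=
  splits_iff_card_roots.1 (IsAlgClosed.splits Q)

theorem le_norm_eval (Q : Polynomial ℂ) (z : ℂ) (ρ : ℝ) (hρ : 0 ≤ ρ)
    (h : ∀ r ∈ Q.roots, ρ ≤ ‖z - r‖) : ‖Q.leadingCoeff‖ * ρ ^ Q.natDegree ≤ ‖Q.eval z‖ := by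
  rw [norm_eval_eq_prod]
  refine mul_le_mul_of_nonneg_left ?_ (norm_nonneg _)
  have := Multiset.prod_map_le_prod_map₀ (s := Q.roots) (fun _ => ρ) (fun r => ‖z - r‖)
    (fun _ _ => hρ) h
  simpa [card_roots_eq] using this

theorem norm_eval_le_exp (Q : Polynomial ℂ) (z₀ : ℂ) (r : ℝ) (hr : 0 < r)
    (h : ∀ a ∈ Q.roots, 2 * r ≤ ‖z₀ - a‖) (x y : ℂ) (hy : dist y z₀ ≤ r) :
    ‖Q.eval x‖ ≤ ‖Q.eval y‖ * Real.exp (Q.natDegree * (‖x - y‖ / r)) := by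
  rw [norm_eval_eq_prod, norm_eval_eq_prod, mul_assoc]
  refine mul_le_mul_of_nonneg_left ?_ (norm_nonneg _)
  have := Multiset.prod_map_le_prod_map₀ (s := Q.roots) (fun a => ‖x - a‖)
    (fun a => ‖y - a‖ * Real.exp (‖x - y‖ / r)) (fun _ _ => norm_nonneg _) (by
      intro a ha
      have h1 := h a ha
      have h2 : r ≤ ‖y - a‖ := by
        have := norm_sub_le_norm_sub_add_norm_sub z₀ y a
        rw [dist_comm, dist_eq_norm] at hy
        linarith
      have h3 : ‖x - a‖ ≤ ‖x - y‖ + ‖y - a‖ := norm_sub_le_norm_sub_add_norm_sub x y a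
      have h4 : ‖x - y‖ / r + 1 ≤ Real.exp (‖x - y‖ / r) := Real.add_one_le_exp _
      have h5 : ‖x - y‖ ≤ ‖y - a‖ * (‖x - y‖ / r) := by
        calc ‖x - y‖ = r * (‖x - y‖ / r) := by field_simp
          _ ≤ _ := by gcongr
      nlinarith [norm_nonneg (y - a)])
  rw [Multiset.prod_map_mul] at this
  simpa [card_roots_eq, ← Real.exp_nat_mul] using this

/-- `P^n(z) - z` as a polynomial. -/
def perPoly (P : Polynomial ℂ) (n : ℕ) : Polynomial ℂ := P.comp^[n] X - X

theorem perPoly_eval (P : Polynomial ℂ) (n : ℕ) (z : ℂ) :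
    (perPoly P n).eval z = (fun z => P.eval z)^[n] z - z := by
  simp [perPoly, iterate_comp_eval]

theorem natDegree_iter (P : Polynomial ℂ) (n : ℕ) :
    (P.comp^[n] X).natDegree = P.natDegree ^ n := by
  simp [natDegree_iterate_comp]

theorem one_lt_pow_deg {d n : ℕ} (hd : 2 ≤ d) (hn : n ≠ 0) : 1 < d ^ n :=
  Nat.one_lt_pow hn (by omega)

theorem natDegree_perPoly (P : Polynomial ℂ) (hdeg : 2 ≤ P.natDegree) (n : ℕ) (hn : n ≠ 0) :
    (perPoly P n).natDegree = P.natDegree ^ n := by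
  rw [perPoly, natDegree_sub_eq_left_of_natDegree_lt, natDegree_iter]
  rw [natDegree_iter, natDegree_X]
  exact one_lt_pow_deg hdeg hn

theorem leadingCoeff_perPoly (P : Polynomial ℂ) (hdeg : 2 ≤ P.natDegree) (n : ℕ) (hn : n ≠ 0) :
    (perPoly P n).leadingCoeff = (P.comp^[n] X).leadingCoeff := by
  rw [perPoly, leadingCoeff_sub_of_degree_lt]
  rw [← natDegree_lt_natDegree_iff X_ne_zero, natDegree_iter, natDegree_X]
  exact one_lt_pow_deg hdeg hn

theorem lc_bound (P : Polynomial ℂ) (hdeg : 2 ≤ P.natDegree) (a : ℝ) (ha : 0 < a) (ha1 : a ≤ 1)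
    (h : a ≤ ‖P.leadingCoeff‖) (n : ℕ) :
    a ^ (P.natDegree ^ n) ≤ a * ‖(P.comp^[n] X).leadingCoeff‖ := by
  induction n with
  | zero => simp
  | succ n ih =>
    rw [Function.iterate_succ_apply', leadingCoeff_comp, norm_mul, norm_pow, pow_succ, pow_mul]
    · set l := ‖(P.comp^[n] X).leadingCoeff‖
      calc (a ^ P.natDegree ^ n) ^ P.natDegree ≤ (a * l) ^ P.natDegree := by gcongr
        _ = a ^ P.natDegree * l ^ P.natDegree := mul_pow _ _ _
        _ ≤ a ^ 2 * l ^ P.natDegree := by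
          exact mul_le_mul_of_nonneg_right (pow_le_pow_of_le_one ha.le ha1 hdeg) (by positivity)
        _ ≤ a * (‖P.leadingCoeff‖ * l ^ P.natDegree) := by
          rw [sq, mul_assoc]; gcongr
    · rw [natDegree_iter]; positivity

/-- Near criterion. -/
theorem exists_periodic_of_small (P : Polynomial ℂ) (hdeg : 2 ≤ P.natDegree) (a : ℝ) (ha : 0 < a)
    (ha1 : a ≤ 1) (h : a ≤ ‖P.leadingCoeff‖) (n : ℕ) (hn : n ≠ 0) (c : ℂ) (ρ : ℝ) (hρ : 0 < ρ)
    (hc : ‖(fun z => P.eval z)^[n] c - c‖ < (a * ρ) ^ (P.natDegree ^ n)) :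
    ∃ r, (fun z => P.eval z)^[n] r = r ∧ dist c r < ρ := by
  by_contra hcon
  push Not at hcon
  have h1 := le_norm_eval (perPoly P n) c ρ hρ.le (by
    intro r hr
    have := (mem_roots'.1 hr).2
    rw [IsRoot, perPoly_eval, sub_eq_zero] at this
    rw [← dist_eq_norm]
    exact hcon r this)
  rw [perPoly_eval, natDegree_perPoly P hdeg n hn, leadingCoeff_perPoly P hdeg n hn] at h1
  have h2 := lc_bound P hdeg a ha ha1 h n
  have h3 : a ^ (P.natDegree ^ n) ≤ ‖(P.comp^[n] X).leadingCoeff‖ :=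
    h2.trans (mul_le_of_le_one_left (norm_nonneg _) ha1)
  rw [mul_pow] at hc
  have : a ^ (P.natDegree ^ n) * ρ ^ (P.natDegree ^ n) ≤
    ‖(P.comp^[n] X).leadingCoeff‖ * ρ ^ (P.natDegree ^ n) := by gcongr
  linarith

theorem periodic_mem_filledJulia (f : ℂ → ℂ) (n : ℕ) (hn : n ≠ 0) (r : ℂ) (h : f^[n] r = r) :
    r ∈ filledJulia f := by
  have hper : Function.IsPeriodicPt f n r := h
  refine (Set.Finite.subset ((Set.finite_Iio n).image fun k => f^[k] r) ?_).isBounded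
  rintro _ ⟨k, rfl⟩
  refine ⟨k % n, Nat.mod_lt _ (by omega), ?_⟩
  exact hper.iterate_mod_apply k

/-- Escape data for `P`. -/
structure Escape (P : Polynomial ℂ) (b : ℝ) (R : ℕ) : Prop where
  bpos : 0 < b
  ble : b ≤ 1
  hR : 1 ≤ R
  hbR : 2 ≤ b * R
  grow : ∀ z : ℂ, (R : ℝ) ≤ ‖z‖ → b * ‖z‖ ^ P.natDegree ≤ ‖P.eval z‖

theorem exists_escape (P : Polynomial ℂ) (hdeg : 2 ≤ P.natDegree) : ∃ b R, Escape P b R := by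
  have hlc : 0 < ‖P.leadingCoeff‖ := by
    rw [norm_pos_iff, Ne, leadingCoeff_eq_zero]
    rintro rfl
    simp at hdeg
  set b := min 1 (‖P.leadingCoeff‖ * (1/2) ^ P.natDegree) with hb
  have hbpos : 0 < b := by positivity
  obtain ⟨M, hM⟩ : ∃ M : ℝ, ∀ r ∈ P.roots, ‖r‖ ≤ M := by
    obtain ⟨M, hM⟩ := (P.roots.toFinset.finite_toSet).isBounded.exists_norm_le
    exact ⟨M, fun r hr => hM r (by simpa using hr)⟩
  obtain ⟨R, hR⟩ := exists_nat_ge (max (2 * M) (max 1 (2 / b)))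
  have h1 : 2 * M ≤ R := (le_max_left _ _).trans hR
  have h2 : (1:ℝ) ≤ R := ((le_max_left _ _).trans (le_max_right _ _)).trans hR
  have h3 : 2 / b ≤ R := ((le_max_right _ _).trans (le_max_right _ _)).trans hR
  refine ⟨b, R, hbpos, min_le_left _ _, by exact_mod_cast h2, ?_, ?_⟩
  · rw [div_le_iff₀ hbpos] at h3; linarith
  · intro z hz
    have := le_norm_eval P z (‖z‖ / 2) (by positivity) (by
      intro r hr
      have := hM r hr
      have := norm_sub_norm_le z r
      linarith)
    refine le_trans ?_ this
    have hb2 : b ≤ ‖P.leadingCoeff‖ * (1/2) ^ P.natDegree := min_le_right _ _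
    calc b * ‖z‖ ^ P.natDegree ≤ ‖P.leadingCoeff‖ * (1/2) ^ P.natDegree * ‖z‖ ^ P.natDegree := by
          gcongr
      _ = _ := by rw [div_eq_mul_inv, mul_pow]; ring

variable {P : Polynomial ℂ} {b : ℝ} {R : ℕ}

theorem Escape.double (h : Escape P b R) (hdeg : 2 ≤ P.natDegree) (z : ℂ) (hz : (R : ℝ) ≤ ‖z‖) :
    2 * ‖z‖ ≤ ‖P.eval z‖ := by
  have h1 : (1:ℝ) ≤ R := by exact_mod_cast h.hR
  refine le_trans ?_ (h.grow z hz)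
  have : ‖z‖ ^ 2 ≤ ‖z‖ ^ P.natDegree := pow_le_pow_right₀ (h1.trans hz) hdeg
  have hb := h.bpos
  calc 2 * ‖z‖ ≤ (b * R) * ‖z‖ := by gcongr; exact h.hbR
    _ ≤ (b * ‖z‖) * ‖z‖ := by gcongr
    _ = b * ‖z‖ ^ 2 := by ring
    _ ≤ _ := by gcongr

theorem Escape.iter (h : Escape P b R) (hdeg : 2 ≤ P.natDegree) (z : ℂ) (hz : (R : ℝ) ≤ ‖z‖)
    (n : ℕ) : (R : ℝ) ≤ ‖(fun z => P.eval z)^[n] z‖ ∧ 2 ^ n ≤ ‖(fun z => P.eval z)^[n] z‖ ∧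
      (b * ‖z‖) ^ (P.natDegree ^ n) ≤ b * ‖(fun z => P.eval z)^[n] z‖ := by
  have hR : (1:ℝ) ≤ R := by exact_mod_cast h.hR
  have hb := h.bpos
  induction n with
  | zero => simp; exact ⟨hz, hR.trans hz⟩
  | succ n ih =>
    rw [Function.iterate_succ_apply']
    obtain ⟨i1, i2, i3⟩ := ih
    set w := (fun z => P.eval z)^[n] z
    have h1 := h.double hdeg w i1
    have h2 := h.grow w i1
    refine ⟨by linarith [norm_nonneg w], by rw [pow_succ]; linarith, ?_⟩
    rw [pow_succ, pow_mul]
    calc ((b * ‖z‖) ^ P.natDegree ^ n) ^ P.natDegree ≤ (b * ‖w‖) ^ P.natDegree := by gcongr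
      _ = b ^ P.natDegree * ‖w‖ ^ P.natDegree := mul_pow _ _ _
      _ ≤ b ^ 2 * ‖w‖ ^ P.natDegree := by
          exact mul_le_mul_of_nonneg_right (pow_le_pow_of_le_one hb.le h.ble hdeg) (by positivity)
      _ = b * (b * ‖w‖ ^ P.natDegree) := by ring
      _ ≤ _ := by gcongr

theorem Escape.norm_lt (h : Escape P b R) (hdeg : 2 ≤ P.natDegree) {z : ℂ}
    (hz : z ∈ filledJulia fun z => P.eval z) (n : ℕ) : ‖(fun z => P.eval z)^[n] z‖ < R := by
  by_contra hcon
  push Not at hcon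
  obtain ⟨M, hM⟩ := (show Bornology.IsBounded (Set.range fun n : ℕ => (fun z => P.eval z)^[n] z) from hz).exists_norm_le
  obtain ⟨k, hk⟩ := pow_unbounded_of_one_lt M (one_lt_two)
  have h1 := (h.iter hdeg _ hcon k).2.1
  rw [← Function.iterate_add_apply] at h1
  have := hM _ ⟨k + n, rfl⟩
  linarith

theorem exists_norm_gt {z : ℂ} (hz : z ∉ filledJulia fun z => P.eval z) (A : ℝ) :
    ∃ n, A < ‖(fun z => P.eval z)^[n] z‖ := by
  by_contra hcon
  push Not at hcon
  apply hz
  show Bornology.IsBounded (Set.range fun n : ℕ => (fun z => P.eval z)^[n] z)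
  refine isBounded_iff_forall_norm_le.2 ⟨A, ?_⟩
  rintro _ ⟨n, rfl⟩
  exact hcon n

theorem continuous_iter (P : Polynomial ℂ) (n : ℕ) : Continuous (fun z => P.eval z)^[n] :=
  P.continuous.iterate n

theorem Escape.isCompact (h : Escape P b R) (hdeg : 2 ≤ P.natDegree) :
    IsCompact (filledJulia fun z => P.eval z) := by
  have heq : (filledJulia fun z => P.eval z) =
      ⋂ n : ℕ, {z | ‖(fun z => P.eval z)^[n] z‖ ≤ R} := by
    ext z
    simp only [mem_iInter, mem_ofPred_eq]
    constructor
    · intro hz n; exact (h.norm_lt hdeg hz n).le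
    · intro hz
      by_contra hcon
      obtain ⟨n, hn⟩ := exists_norm_gt hcon R
      exact absurd (hz n) (not_le.2 hn)
  refine Metric.isCompact_of_isClosed_isBounded ?_ ?_
  · rw [heq]
    exact isClosed_iInter fun n => isClosed_le (continuous_iter P n).norm continuous_const
  · exact isBounded_iff_forall_norm_le.2 ⟨R, fun z hz => (h.norm_lt hdeg hz 0).le⟩

theorem filledJulia_nonempty (P : Polynomial ℂ) (hdeg : 2 ≤ P.natDegree) :
    (filledJulia fun z => P.eval z).Nonempty := by
  have hd := natDegree_perPoly P hdeg 1 one_ne_zero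
  obtain ⟨r, hr⟩ := IsAlgClosed.exists_root (perPoly P 1) (by
    intro h0
    have := natDegree_eq_of_degree_eq_some (n := 0) h0
    rw [pow_one] at hd
    omega)
  rw [IsRoot, perPoly_eval, sub_eq_zero] at hr
  exact ⟨r, periodic_mem_filledJulia _ 1 one_ne_zero r hr⟩

theorem Escape.log_growth (h : Escape P b R) (hdeg : 2 ≤ P.natDegree) {z : ℂ}
    (hz : z ∉ filledJulia fun z => P.eval z) :
    ∃ δ : ℝ, 0 < δ ∧ ∃ N : ℕ, ∀ n ≥ N,
      Real.exp (δ * (P.natDegree : ℝ) ^ n) ≤ ‖(fun z => P.eval z)^[n] z - z‖ := by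
  obtain ⟨j, hj⟩ := exists_norm_gt hz R
  set d := P.natDegree with hd
  have hdpos : (0:ℝ) < (d:ℝ) ^ j := by positivity
  obtain ⟨N, hN⟩ := pow_unbounded_of_one_lt (2 * ‖z‖) (one_lt_two)
  refine ⟨Real.log 2 / 2 / (d:ℝ)^j, div_pos (half_pos (Real.log_pos one_lt_two)) hdpos,
    j + N + 1, fun n hn => ?_⟩
  obtain ⟨i, rfl⟩ : ∃ i, n = i + j := ⟨n - j, by omega⟩
  have h1 := (h.iter hdeg _ hj.le i).2.2
  rw [← Function.iterate_add_apply] at h1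
  set w := (fun z => P.eval z)^[i + j] z
  have hb := h.bpos
  have h2 : (2:ℝ) ^ (d ^ i) ≤ ‖w‖ := by
    calc (2:ℝ) ^ (d ^ i) ≤ (b * ‖(fun z => P.eval z)^[j] z‖) ^ (d ^ i) := by
          have : (2:ℝ) ≤ b * ‖(fun z => P.eval z)^[j] z‖ := h.hbR.trans (by gcongr)
          gcongr
      _ ≤ b * ‖w‖ := h1
      _ ≤ ‖w‖ := mul_le_of_le_one_left (norm_nonneg _) h.ble
  have hid : i < d ^ i := Nat.lt_pow_self (by omega)
  have h3 : 2 * ‖z‖ ≤ (2:ℝ) ^ (d ^ i) := 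
    hN.le.trans (pow_le_pow_right₀ one_le_two (by omega))
  have h4 : ‖w‖ - ‖z‖ ≤ ‖w - z‖ := norm_sub_norm_le _ _
  have h5 : Real.exp (Real.log 2 / 2 / (d:ℝ)^j * (d:ℝ) ^ (i + j)) ≤ (2:ℝ) ^ (d ^ i) / 2 := by
    have e1 : Real.log 2 / 2 / (d:ℝ)^j * (d:ℝ) ^ (i + j) = Real.log 2 * ((d:ℝ)^i / 2) := by
      rw [pow_add]; field_simp
    have e2 : (2:ℝ) ^ (d ^ i) / 2 = Real.exp (Real.log 2 * ((d:ℝ)^i - 1)) := by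
      rw [mul_sub, Real.exp_sub, mul_one, Real.exp_log two_pos, ← Real.rpow_def_of_pos two_pos]
      congr 1
      exact_mod_cast (Real.rpow_natCast 2 (d^i)).symm
    rw [e1, e2, Real.exp_le_exp]
    have : (2:ℝ) ≤ (d:ℝ)^i := by
      have : 2 ≤ d ^ i := by omega
      exact_mod_cast this
    have := Real.log_pos one_lt_two
    nlinarith
  linarith

theorem circleAverage_bump_pos (z₀ w : ℂ) (δ r : ℝ) (hδ : 0 < δ) (hw : w ≠ z₀) :
    0 < Real.circleAverage (fun z => max 0 (δ - ‖z - w‖ / r)) z₀ (dist w z₀) := by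
  set s := dist w z₀ with hs
  obtain ⟨θ, hθ⟩ : ∃ θ : ℝ, circleMap z₀ s θ = w := by
    have : w ∈ Metric.sphere z₀ |s| := by rw [abs_of_nonneg dist_nonneg]; exact rfl
    rw [← range_circleMap] at this
    exact this
  have hcont : Continuous fun t : ℝ => max 0 (δ - ‖circleMap z₀ s t - w‖ / r) := by fun_prop
  rw [Real.circleAverage_eq_integral_add θ]
  have hc2 : Continuous fun t : ℝ => max 0 (δ - ‖circleMap z₀ s (t + θ) - w‖ / r) := by fun_prop
  refine smul_pos (by positivity) ?_
  refine intervalIntegral.integral_pos Real.two_pi_pos hc2.continuousOn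
    (fun _ _ => le_max_left _ _) ⟨0, ⟨le_rfl, Real.two_pi_pos.le⟩, ?_⟩
  simp [hθ, hδ]

theorem periodic_dense (hdeg : 2 ≤ P.natDegree)
    (hint : interior (filledJulia fun z => P.eval z) = ∅) (z₀ : ℂ)
    (hz₀ : z₀ ∈ filledJulia fun z => P.eval z) (ε : ℝ) (hε : 0 < ε) :
    ∃ n, n ≠ 0 ∧ ∃ r, (fun z => P.eval z)^[n] r = r ∧ dist z₀ r < ε := by
  by_contra hcon
  push Not at hcon
  obtain ⟨b, R, hE⟩ := exists_escape P hdeg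
  set K := filledJulia fun z => P.eval z with hK
  set d := P.natDegree with hd
  set r := ε / 2 with hr
  have hr0 : 0 < r := half_pos hε
  have hroots : ∀ n, n ≠ 0 → ∀ a ∈ (perPoly P n).roots, 2 * r ≤ ‖z₀ - a‖ := by
    intro n hn a ha
    have := (mem_roots'.1 ha).2
    rw [IsRoot, perPoly_eval, sub_eq_zero] at this
    have := hcon n hn a this
    rw [← dist_eq_norm]; linarith
  have hdense : Dense Kᶜ := interior_eq_empty_iff_dense_compl.1 hint
  obtain ⟨w, hwK, hw⟩ : ∃ w ∈ Kᶜ, dist w z₀ < r := by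
    obtain ⟨w, hw1, hw2⟩ := hdense.exists_dist_lt z₀ hr0
    exact ⟨w, hw1, by rwa [dist_comm]⟩
  have hwz : w ≠ z₀ := by rintro rfl; exact hwK hz₀
  set s := dist w z₀ with hs
  have hs0 : 0 < s := dist_pos.2 hwz
  obtain ⟨δ, hδ, N₁, hN₁⟩ := hE.log_growth hdeg hwK
  set ψ : ℂ → ℝ := fun z => max 0 (δ - ‖z - w‖ / r) with hψ
  set κ := Real.circleAverage ψ z₀ s with hκ
  have hκ0 : 0 < κ := circleAverage_bump_pos z₀ w δ r hδ hwz
  -- finite net on the sphere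
  obtain ⟨T, hTK, hTcov⟩ : ∃ T : Finset ℂ, (∀ y ∈ T, y ∈ Kᶜ ∧ dist y z₀ ≤ r) ∧
      ∀ x ∈ Metric.sphere z₀ s, ∃ y ∈ T, ‖y - x‖ < r * (κ / 2) := by
    have hcomp : IsCompact (Metric.sphere z₀ s) := isCompact_sphere _ _
    let ι := {y : ℂ // y ∈ Kᶜ ∧ dist y z₀ ≤ r}
    obtain ⟨t, ht⟩ := hcomp.elim_finite_subcover (fun y : ι => Metric.ball y.1 (r * (κ/2)))
      (fun _ => Metric.isOpen_ball) (by
        intro x hx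
        have hrk : 0 < r * (κ/2) := by positivity
        obtain ⟨y, hy1, hy2⟩ := hdense.exists_dist_lt x (lt_min hrk (sub_pos.2 hw))
        have h1 := lt_of_lt_of_le hy2 (min_le_left _ _)
        have h2 := lt_of_lt_of_le hy2 (min_le_right _ _)
        refine mem_iUnion.2 ⟨⟨y, hy1, ?_⟩, h1⟩
        have := dist_triangle y x z₀
        rw [mem_sphere.1 hx, dist_comm y x] at this
        linarith)
    classical
    refine ⟨t.image Subtype.val, ?_, ?_⟩
    · intro y hy
      obtain ⟨y', _, rfl⟩ := Finset.mem_image.1 hy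
      exact y'.2
    · intro x hx
      obtain ⟨y, hy, hxy⟩ := mem_iUnion₂.1 (ht hx)
      refine ⟨y.1, Finset.mem_image_of_mem _ hy, ?_⟩
      rw [← dist_eq_norm, dist_comm]; exact hxy
  -- eventually positive on the net
  have hev : ∀ y ∈ T, ∀ᶠ n : ℕ in atTop, 1 ≤ ‖(fun z => P.eval z)^[n] y - y‖ := by
    intro y hy
    obtain ⟨δ', hδ', N, hN⟩ := hE.log_growth hdeg (hTK y hy).1
    filter_upwards [eventually_ge_atTop N] with n hn
    exact le_trans (Real.one_le_exp (by positivity)) (hN n hn)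
  have hev2 : ∀ᶠ n : ℕ in atTop, ∀ y ∈ T, 1 ≤ ‖(fun z => P.eval z)^[n] y - y‖ :=
    (Filter.eventually_all_finset T).2 hev
  have hlim : Tendsto (fun n : ℕ => (d:ℝ) ^ n * (κ / 2)) atTop atTop :=
    (tendsto_pow_atTop_atTop_of_one_lt (by
      have : 1 < d := by omega
      exact_mod_cast this)).atTop_mul_const (by positivity)
  obtain ⟨n, hnT, hnN, hn1, hnlim⟩ := (hev2.and ((eventually_ge_atTop N₁).and
    ((eventually_ge_atTop 1).and (hlim.eventually_gt_atTop (Real.log (2 * R)))))).exists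
  have hn0 : n ≠ 0 := by omega
  set Q := perPoly P n with hQ
  have hQd : Q.natDegree = d ^ n := natDegree_perPoly P hdeg n hn0
  set D : ℝ := (d:ℝ) ^ n with hD
  have hD0 : 0 < D := by positivity
  have hlip := norm_eval_le_exp Q z₀ r hr0 (hroots n hn0)
  rw [hQd] at hlip
  push_cast at hlip
  have hne : ∀ x ∈ Metric.closedBall z₀ |s|, Q.eval x ≠ 0 := by
    intro x hx h0
    rw [abs_of_pos hs0, mem_closedBall] at hx
    have : x ∈ Q.roots := by
      rw [mem_roots', IsRoot]
      refine ⟨?_, h0⟩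
      intro hq
      rw [hq, natDegree_zero] at hQd
      have := one_lt_pow_deg hdeg hn0
      omega
    have := hroots n hn0 x this
    rw [← dist_eq_norm, dist_comm] at this
    linarith
  have hmean : Real.circleAverage (fun z => Real.log ‖Q.eval z‖) z₀ s = Real.log ‖Q.eval z₀‖ :=
    AnalyticOnNhd.circleAverage_log_norm_of_ne_zero (g := fun z => Q.eval z)
      (fun x _ => Q.differentiable.analyticAt x) hne
  have hci1 : CircleIntegrable (fun z => Real.log ‖Q.eval z‖) z₀ s := by
    apply ContinuousOn.circleIntegrable'
    refine ContinuousOn.log (Q.continuous.norm.continuousOn) ?_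
    intro x hx
    exact norm_ne_zero_iff.2 (hne x (sphere_subset_closedBall hx))
  have hci2 : CircleIntegrable ψ z₀ s := by
    apply ContinuousOn.circleIntegrable'
    apply Continuous.continuousOn
    fun_prop
  have hbound : ∀ x ∈ Metric.sphere z₀ |s|, D * ψ x - D * (κ/2) ≤ Real.log ‖Q.eval x‖ := by
    intro x hx
    have hx' : x ∈ Metric.sphere z₀ s := by rwa [abs_of_pos hs0] at hx
    have hxr : dist x z₀ ≤ r := by rw [mem_sphere.1 hx']; exact hw.le
    have hxpos : 0 < ‖Q.eval x‖ := norm_pos_iff.2 (hne x (sphere_subset_closedBall hx))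
    have hl1 : -(D * (κ/2)) ≤ Real.log ‖Q.eval x‖ := by
      obtain ⟨y, hy, hyx⟩ := hTcov x hx'
      have h1 := hlip y x hxr
      have h2 := hnT y hy
      rw [← perPoly_eval] at h2
      have h3 := h2.trans h1
      have h4 := Real.log_le_log one_pos h3
      rw [Real.log_one, Real.log_mul hxpos.ne' (Real.exp_ne_zero _), Real.log_exp] at h4
      have h5 : ‖y - x‖ / r ≤ κ / 2 := by
        rw [div_le_iff₀ hr0]; linarith
      have h6 : D * (‖y - x‖ / r) ≤ D * (κ/2) := by gcongr
      linarith
    have hl2 : D * (δ - ‖x - w‖ / r) ≤ Real.log ‖Q.eval x‖ := by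
      have h1 := hlip w x hxr
      have h2 := hN₁ n hnN
      rw [← perPoly_eval] at h2
      have h4 := Real.log_le_log (Real.exp_pos _) (h2.trans h1)
      rw [Real.log_exp, Real.log_mul hxpos.ne' (Real.exp_ne_zero _), Real.log_exp,
        norm_sub_rev] at h4
      linarith
    simp only [hψ]
    have : 0 < D * (κ/2) := by positivity
    rcases max_cases 0 (δ - ‖x - w‖ / r) with ⟨h, _⟩ | ⟨h, _⟩ <;> rw [h] <;> linarith
  have hmono := Real.circleAverage_mono (c := z₀) (R := s) (f₁ := fun x => D * ψ x - D * (κ/2))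
    (by
      apply ContinuousOn.circleIntegrable'
      apply Continuous.continuousOn
      fun_prop) hci1 hbound
  rw [hmean] at hmono
  have hav : Real.circleAverage (fun x => D * ψ x - D * (κ/2)) z₀ s = D * κ - D * (κ/2) := by
    rw [Real.circleAverage_fun_sub (f₁ := fun x => D * ψ x) (f₂ := fun _ => D * (κ/2)),
      Real.circleAverage_const]
    · congr 1
      exact Real.circleAverage_fun_smul (a := D) (f := ψ)
    · apply ContinuousOn.circleIntegrable'
      apply Continuous.continuousOn
      fun_prop
    · exact circleIntegrable_const _ _ _
  rw [hav, perPoly_eval] at hmono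
  have h1 := hE.norm_lt hdeg hz₀ n
  have h2 := hE.norm_lt hdeg hz₀ 0
  have h3 : ‖(fun z => P.eval z)^[n] z₀ - z₀‖ ≤ 2 * R := by
    refine (norm_sub_le _ _).trans ?_
    simp only [Function.iterate_zero, id] at h2
    linarith
  have hpos : 0 < ‖(fun z => P.eval z)^[n] z₀ - z₀‖ := by
    rw [← perPoly_eval]
    exact norm_pos_iff.2 (hne z₀ (mem_closedBall_self (abs_nonneg _)))
  have h4 := Real.log_le_log hpos h3
  linarith

end PartB
/-! ### Part C: approximation of polynomials -/

section PartC

variable {α : Type*} [Primcodable α]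

/-- addition of rational points -/
def qAdd (u v : ℚ × ℚ) : ℚ × ℚ := (u.1 + v.1, u.2 + v.2)
/-- subtraction of rational points -/
def qSub (u v : ℚ × ℚ) : ℚ × ℚ := (u.1 - v.1, u.2 - v.2)
/-- multiplication of rational points -/
def qMul (u v : ℚ × ℚ) : ℚ × ℚ := (u.1 * v.1 - u.2 * v.2, u.1 * v.2 + u.2 * v.1)
/-- squared norm of a rational point -/
def nsq (u : ℚ × ℚ) : ℚ := u.1 * u.1 + u.2 * u.2

theorem ratPoint_qAdd (u v : ℚ × ℚ) : ratPoint (qAdd u v) = ratPoint u + ratPoint v := by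
  apply Complex.ext <;> simp [ratPoint, qAdd]

theorem ratPoint_qSub (u v : ℚ × ℚ) : ratPoint (qSub u v) = ratPoint u - ratPoint v := by
  apply Complex.ext <;> simp [ratPoint, qSub]

theorem ratPoint_qMul (u v : ℚ × ℚ) : ratPoint (qMul u v) = ratPoint u * ratPoint v := by
  apply Complex.ext <;> simp [ratPoint, qMul]

theorem nsq_eq (u : ℚ × ℚ) : (nsq u : ℝ) = ‖ratPoint u‖ ^ 2 := by
  rw [Complex.sq_norm, Complex.normSq_apply]
  simp [ratPoint, nsq]

theorem nsq_le_iff (u : ℚ × ℚ) (b : ℚ) (hb : 0 ≤ b) : nsq u ≤ b ^ 2 ↔ ‖ratPoint u‖ ≤ (b : ℝ) := by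
  have hb' : (0:ℝ) ≤ (b:ℝ) := by exact_mod_cast hb
  rw [← pow_le_pow_iff_left₀ (norm_nonneg _) hb' two_ne_zero, ← nsq_eq]
  exact_mod_cast Iff.rfl

theorem cQAdd {f g : α → ℚ × ℚ} (hf : Computable f) (hg : Computable g) :
    Computable fun a => qAdd (f a) (g a) :=
  (cRatAdd (Computable.fst.comp hf) (Computable.fst.comp hg)).pair
    (cRatAdd (Computable.snd.comp hf) (Computable.snd.comp hg))

theorem cQSub {f g : α → ℚ × ℚ} (hf : Computable f) (hg : Computable g) :
    Computable fun a => qSub (f a) (g a) :=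
  (cRatSub (Computable.fst.comp hf) (Computable.fst.comp hg)).pair
    (cRatSub (Computable.snd.comp hf) (Computable.snd.comp hg))

theorem cQMul {f g : α → ℚ × ℚ} (hf : Computable f) (hg : Computable g) :
    Computable fun a => qMul (f a) (g a) :=
  (cRatSub (cRatMul (Computable.fst.comp hf) (Computable.fst.comp hg))
    (cRatMul (Computable.snd.comp hf) (Computable.snd.comp hg))).pair
    (cRatAdd (cRatMul (Computable.fst.comp hf) (Computable.snd.comp hg))
    (cRatMul (Computable.snd.comp hf) (Computable.fst.comp hg)))

theorem cNsq {f : α → ℚ × ℚ} (hf : Computable f) : Computable fun a => nsq (f a) :=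
  cRatAdd (cRatMul (Computable.fst.comp hf) (Computable.fst.comp hf))
    (cRatMul (Computable.snd.comp hf) (Computable.snd.comp hf))

/-- `F` is computably approximable on rational points of the disc of radius `A`. -/
def CApprox (A : ℕ) (F : ℂ → ℂ) : Prop :=
  ∃ p : ℕ → ℚ × ℚ → ℚ × ℚ, Computable₂ p ∧ ∀ t w, ‖ratPoint w‖ ≤ A →
    ‖ratPoint (p t w) - F (ratPoint w)‖ ≤ (1 / 2) ^ t

theorem CApprox.const (A : ℕ) {c : ℂ} (hc : ComputableComplex c) : CApprox A fun _ => c := by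
  obtain ⟨⟨g, hg, hg'⟩, ⟨h, hh, hh'⟩⟩ := hc
  refine ⟨fun t _ => (g (t+1), h (t+1)), ?_, ?_⟩
  · apply Computable₂.mk
    have hs : Computable fun a : ℕ × (ℚ × ℚ) => a.1 + 1 := Computable.succ.comp Computable.fst
    exact (hg.comp hs).pair (hh.comp hs)
  · intro t w _
    refine (Complex.norm_le_abs_re_add_abs_im _).trans ?_
    have h1 := hg' (t+1)
    have h2 := hh' (t+1)
    simp only [ratPoint, Complex.sub_re, Complex.sub_im]
    rw [pow_succ] at h1 h2
    linarith

theorem CApprox.step {A : ℕ} {F : ℂ → ℂ} (hF : CApprox A F) {c : ℂ} (hc : ComputableComplex c) :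
    CApprox A fun z => F z * z + c := by
  obtain ⟨p, hp, hp'⟩ := hF
  obtain ⟨q, hq, hq'⟩ := CApprox.const A hc
  refine ⟨fun t w => qAdd (qMul (p (t + 1 + A) w) w) (q (t+1) w), ?_, ?_⟩
  · apply Computable₂.mk
    have hs : Computable fun a : ℕ × (ℚ × ℚ) => a.1 + 1 := Computable.succ.comp Computable.fst
    exact cQAdd (cQMul (hp.comp (cNatAdd hs (Computable.const A)) Computable.snd) Computable.snd)
      (hq.comp hs Computable.snd)
  · intro t w hw
    have h1 := hp' (t + 1 + A) w hw
    have h2 := hq' (t+1) w hw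
    rw [ratPoint_qAdd, ratPoint_qMul]
    set z := ratPoint w
    set u := ratPoint (p (t + 1 + A) w)
    set v := ratPoint (q (t+1) w)
    have e : u * z + v - (F z * z + c) = (u - F z) * z + (v - c) := by ring
    rw [e]
    refine (norm_add_le _ _).trans ?_
    rw [norm_mul]
    have h3 : ‖z‖ ≤ 2 ^ A := hw.trans (by exact_mod_cast Nat.lt_two_pow_self.le)
    have h4 : ‖u - F z‖ * ‖z‖ ≤ (1/2) ^ (t + 1 + A) * 2 ^ A := by gcongr
    have h5 : ((1:ℝ)/2) ^ (t + 1 + A) * 2 ^ A = (1/2)^(t+1) := by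
      rw [pow_add, mul_assoc, ← mul_pow]; norm_num
    rw [h5] at h4
    rw [pow_succ] at h4 h2
    linarith

theorem CApprox.poly (A : ℕ) (N : ℕ) : ∀ (P : Polynomial ℂ), P.natDegree ≤ N →
    (∀ i, ComputableComplex (P.coeff i)) → CApprox A fun z => P.eval z := by
  induction N with
  | zero =>
    intro P hd hP
    rw [Polynomial.eq_C_of_natDegree_le_zero hd]
    simpa using CApprox.const A (hP 0)
  | succ N ih =>
    intro P hd hP
    have := (ih P.divX (by rw [natDegree_divX_eq_natDegree_tsub_one]; omega)
      (fun i => by rw [coeff_divX]; exact hP _)).step (hP 0)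
    have e : (fun z => P.eval z) = fun z => P.divX.eval z * z + P.coeff 0 := by
      funext z
      conv_lhs => rw [← divX_mul_X_add P]
      simp
    rw [e]
    exact this

theorem exists_lip (P : Polynomial ℂ) (A : ℝ) : ∃ l : ℕ, 1 ≤ l ∧ ∀ x y : ℂ, ‖x‖ ≤ A → ‖y‖ ≤ A →
    ‖P.eval x - P.eval y‖ ≤ 2 ^ l * ‖x - y‖ := by
  obtain ⟨M, hM⟩ := (isCompact_closedBall (0:ℂ) A).exists_bound_of_continuousOn
    (f := fun z => P.derivative.eval z) P.derivative.continuous.continuousOn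
  obtain ⟨l, hl⟩ := pow_unbounded_of_one_lt M (one_lt_two)
  refine ⟨l + 1, by omega, fun x y hx hy => ?_⟩
  refine (convex_closedBall (0:ℂ) A).norm_image_sub_le_of_norm_deriv_le (𝕜 := ℂ)
    (f := fun z => P.eval z) (fun z _ => P.differentiableAt) ?_
    (by simpa using hy) (by simpa using hx)
  intro z hz
  rw [Polynomial.deriv]
  refine (hM z hz).trans (hl.le.trans ?_)
  exact pow_le_pow_right₀ one_le_two (by omega)

theorem shadow (f : ℂ → ℂ) (A L e : ℝ) (hL : 2 ≤ L) (he : 0 ≤ e)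
    (hlip : ∀ x y, ‖x‖ ≤ A + 1 → ‖y‖ ≤ A + 1 → ‖f x - f y‖ ≤ L * ‖x - y‖) (x y : ℕ → ℂ)
    (hx : ∀ j, x (j+1) = f (x j)) (hy : ∀ j, ‖y j‖ ≤ A + 1 → ‖y (j+1) - f (y j)‖ ≤ e)
    (h0 : ‖x 0 - y 0‖ ≤ e) (m : ℕ) (hm : 2 * L ^ m * e ≤ 1)
    (hb : ∀ j ≤ m, ‖x j‖ ≤ A ∨ ‖y j‖ ≤ A) :
    ∀ j ≤ m, ‖x j - y j‖ ≤ 2 * L ^ j * e - e ∧ ‖x j - y j‖ ≤ 1 := by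
  have key : ∀ j ≤ m, 2 * L ^ j * e ≤ 1 := by
    intro j hj
    refine le_trans ?_ hm
    have : L ^ j ≤ L ^ m := pow_le_pow_right₀ (by linarith) hj
    gcongr
  intro j
  induction j with
  | zero =>
    intro _
    have := key 0 (by omega)
    constructor <;> simp at this ⊢ <;> linarith
  | succ j ih =>
    intro hj
    obtain ⟨i1, i2⟩ := ih (by omega)
    have h1 := key (j+1) hj
    have hxj : ‖x j‖ ≤ A + 1 ∧ ‖y j‖ ≤ A + 1 := by
      have t1 := norm_sub_norm_le (x j) (y j)
      have t2 := norm_sub_norm_le (y j) (x j)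
      rw [norm_sub_rev] at t2
      rcases hb j (by omega) with h | h <;> constructor <;> linarith
    have h2 := hlip _ _ hxj.1 hxj.2
    have h3 := hy j hxj.2
    have h4 : ‖x (j+1) - y (j+1)‖ ≤ L * ‖x j - y j‖ + e := by
      rw [hx]
      have := norm_sub_le_norm_sub_add_norm_sub (f (x j)) (f (y j)) (y (j+1))
      rw [norm_sub_rev (f (y j))] at this
      linarith
    have h5 : L * ‖x j - y j‖ ≤ L * (2 * L ^ j * e - e) := by gcongr
    have h6 : ‖x (j+1) - y (j+1)‖ ≤ 2 * L ^ (j+1) * e - e := by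
      rw [pow_succ]
      nlinarith
    exact ⟨h6, by linarith⟩

end PartC
/-! ### Part D: the algorithm -/

section PartD

variable {α : Type*} [Primcodable α]

/-- Everything the algorithm needs to know. -/
structure Sys (f : ℂ → ℂ) (K : Set ℂ) (p : ℕ → ℚ × ℚ → ℚ × ℚ) (R l a d : ℕ) : Prop where
  cp : Computable₂ p
  cont : Continuous f
  hl : 1 ≤ l
  lip : ∀ x y : ℂ, ‖x‖ ≤ (R:ℝ) + 1 + 1 → ‖y‖ ≤ (R:ℝ) + 1 + 1 → ‖f x - f y‖ ≤ 2 ^ l * ‖x - y‖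
  app : ∀ t w, ‖ratPoint w‖ ≤ (R:ℝ) + 1 + 1 →
    ‖ratPoint (p t w) - f (ratPoint w)‖ ≤ (1 / 2) ^ t
  bdd : ∀ z ∈ K, ∀ n, ‖f^[n] z‖ ≤ R
  esc : ∀ z, z ∉ K → ∀ A : ℝ, ∃ n, A < ‖f^[n] z‖
  near : ∀ (n : ℕ), n ≠ 0 → ∀ (c : ℂ) (k : ℕ), ‖f^[n] c - c‖ < (1 / 2) ^ ((a + k) * d ^ n) →
    ∃ r ∈ K, dist c r < (1 / 2) ^ k
  dense : ∀ z ∈ K, ∀ ε : ℝ, 0 < ε → ∃ n, n ≠ 0 ∧ ∃ r ∈ K, f^[n] r = r ∧ dist z r < ε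
  compact : IsCompact K
  nonempty : K.Nonempty

/-- approximate orbit stays in the disc of radius `R+1` up to time `m` -/
def inD (p : ℕ → ℚ × ℚ → ℚ × ℚ) (R t : ℕ) (c : ℚ × ℚ) (m : ℕ) : Bool :=
  allLt (fun j => decide (nsq ((p t)^[j] c) ≤ ((R:ℚ) + 1) ^ 2)) (m + 1)

theorem inD_iff (p : ℕ → ℚ × ℚ → ℚ × ℚ) (R t : ℕ) (c : ℚ × ℚ) (m : ℕ) :
    inD p R t c m = true ↔ ∀ j ≤ m, ‖ratPoint ((p t)^[j] c)‖ ≤ (R:ℝ) + 1 := by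
  rw [inD, allLt_iff]
  refine forall_congr' fun j => ?_
  rw [Nat.lt_succ_iff, decide_eq_true_iff, nsq_le_iff _ _ (by positivity)]
  push_cast
  rfl

theorem cOrbit {p : ℕ → ℚ × ℚ → ℚ × ℚ} (hp : Computable₂ p) {t j : α → ℕ} {c : α → ℚ × ℚ}
    (ht : Computable t) (hc : Computable c) (hj : Computable j) :
    Computable fun a => (p (t a))^[j a] (c a) := by
  refine (Computable.nat_rec (f := j) (g := c) (h := fun a iy => p (t a) iy.2) hj hc ?_).of_eq ?_
  · apply Computable₂.mk
    exact hp.comp (ht.comp Computable.fst) (Computable.snd.comp Computable.snd)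
  · intro a
    induction j a with
    | zero => rfl
    | succ n ih => rw [Function.iterate_succ_apply', ← ih]

theorem cInD {p : ℕ → ℚ × ℚ → ℚ × ℚ} (hp : Computable₂ p) (R : ℕ) {t m : α → ℕ}
    {c : α → ℚ × ℚ} (ht : Computable t) (hc : Computable c) (hm : Computable m) :
    Computable fun a => inD p R (t a) (c a) (m a) := by
  refine cAllLt (p := fun a j => decide (nsq ((p (t a))^[j] (c a)) ≤ ((R:ℚ) + 1) ^ 2))
    (Computable.succ.comp hm) ?_
  apply Computable₂.mk
  exact cRatLe (cNsq (cOrbit hp (ht.comp Computable.fst) (hc.comp Computable.fst) Computable.snd))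
    (Computable.const _)

/-- near test -/
def nearOK (p : ℕ → ℚ × ℚ → ℚ × ℚ) (R l a d n : ℕ) (e : (ℚ × ℚ) × ℕ) : Bool :=
  inD p R (l * (e.2 + 1) + 3 + (a + (n + 1)) * d ^ (e.2 + 1)) e.1 (e.2 + 1) &&
  decide (nsq (qSub ((p (l * (e.2 + 1) + 3 + (a + (n + 1)) * d ^ (e.2 + 1)))^[e.2 + 1] e.1) e.1) ≤
    (1 / 4 : ℚ) ^ ((a + (n + 1)) * d ^ (e.2 + 1) + 1))

theorem cNearOK {p : ℕ → ℚ × ℚ → ℚ × ℚ} (hp : Computable₂ p) (R l a d : ℕ) {n : α → ℕ}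
    {e : α → (ℚ × ℚ) × ℕ} (hn : Computable n) (he : Computable e) :
    Computable fun x => nearOK p R l a d (n x) (e x) := by
  have h1 : Computable fun x => (e x).1 := Computable.fst.comp he
  have h2 : Computable fun x => (e x).2 + 1 := Computable.succ.comp (Computable.snd.comp he)
  have h3 : Computable fun x => (a + (n x + 1)) * d ^ ((e x).2 + 1) :=
    cNatMul (cNatAdd (Computable.const a) (Computable.succ.comp hn)) (cNatPow d h2)
  have h4 : Computable fun x => l * ((e x).2 + 1) + 3 + (a + (n x + 1)) * d ^ ((e x).2 + 1) :=
    cNatAdd (cNatAdd (cNatMul (Computable.const l) h2) (Computable.const 3)) h3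
  exact cAnd (cInD hp R h4 h1 h2) (cRatLe (cNsq (cQSub (cOrbit hp h4 h1 h2) h1))
    (cRatPow _ (Computable.succ.comp h3)))

/-- grid points -/
def gridPt (R t i : ℕ) : ℚ × ℚ :=
  ((i.unpair.1 : ℚ) * (1 / 2) ^ (t + 1) - R, (i.unpair.2 : ℚ) * (1 / 2) ^ (t + 1) - R)

theorem cGridPt (R : ℕ) {t i : α → ℕ} (ht : Computable t) (hi : Computable i) :
    Computable fun x => gridPt R (t x) (i x) := by
  have h1 : Computable fun x => (i x).unpair.1 :=
    Computable.fst.comp (Computable.unpair.comp hi)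
  have h2 : Computable fun x => (i x).unpair.2 :=
    Computable.snd.comp (Computable.unpair.comp hi)
  have h3 : Computable fun x => ((1:ℚ) / 2) ^ (t x + 1) := cRatPow _ (Computable.succ.comp ht)
  exact (cRatSub (cRatMul (cRatCast h1) h3) (Computable.const _)).pair
    (cRatSub (cRatMul (cRatCast h2) h3) (Computable.const _))

theorem grid_coord (R t : ℕ) (x : ℝ) (hx : |x| ≤ R) : ∃ u : ℕ, u ≤ 2 * R * 2 ^ (t + 1) ∧
    |x - ((u : ℝ) * (1 / 2) ^ (t + 1) - R)| ≤ (1 / 2) ^ (t + 1) := by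
  obtain ⟨h1, h2⟩ := abs_le.1 hx
  set s : ℝ := 2 ^ (t + 1) with hs
  have hs0 : 0 < s := by positivity
  have hinv : ((1:ℝ) / 2) ^ (t + 1) = 1 / s := by rw [hs, div_pow, one_pow]
  have hn : 0 ≤ (x + R) * s := mul_nonneg (by linarith) hs0.le
  refine ⟨⌊(x + R) * s⌋₊, ?_, ?_⟩
  · have : (x + R) * s ≤ ((2 * R * 2 ^ (t + 1) : ℕ) : ℝ) := by
      push_cast
      have : x + R ≤ 2 * R := by linarith
      gcongr
    exact Nat.floor_le_of_le this
  · rw [hinv]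
    have f1 := Nat.floor_le hn
    have f2 := Nat.lt_floor_add_one ((x + R) * s)
    set u : ℝ := (⌊(x + R) * s⌋₊ : ℝ)
    have e : x - (u * (1 / s) - R) = ((x + R) * s - u) / s := by field_simp; ring
    rw [e, abs_of_nonneg (div_nonneg (by linarith) hs0.le)]
    gcongr
    linarith

theorem grid_exists (R t : ℕ) (z : ℂ) (hz : ‖z‖ ≤ R) :
    ∃ i < (2 * R * 2 ^ (t + 1) + 1) ^ 2, ‖z - ratPoint (gridPt R t i)‖ ≤ (1 / 2) ^ t := by
  obtain ⟨u, hu, hu'⟩ := grid_coord R t z.re ((Complex.abs_re_le_norm z).trans hz)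
  obtain ⟨v, hv, hv'⟩ := grid_coord R t z.im ((Complex.abs_im_le_norm z).trans hz)
  refine ⟨Nat.pair u v, ?_, ?_⟩
  · refine (Nat.pair_lt_max_add_one_sq u v).trans_le ?_
    have : max u v ≤ 2 * R * 2 ^ (t + 1) := max_le hu hv
    gcongr
  · refine (Complex.norm_le_abs_re_add_abs_im _).trans ?_
    simp only [ratPoint, gridPt, Complex.sub_re, Complex.sub_im, Nat.unpair_pair]
    push_cast
    have : ((1:ℝ)/2)^t = (1/2)^(t+1) + (1/2)^(t+1) := by rw [pow_succ]; ring
    rw [this]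
    exact add_le_add hu' hv'

/-- far test at a point -/
def ptOK (p : ℕ → ℚ × ℚ → ℚ × ℚ) (R l n : ℕ) (L : List ((ℚ × ℚ) × ℕ)) (m i : ℕ) : Bool :=
  !(inD p R (l * m + 1) (gridPt R (l * m + 1) i) m) ||
  !(L.all fun e => !(decide (nsq (qSub (gridPt R (l * m + 1) i) e.1) ≤ (1 / 4 : ℚ) ^ (n + 2))))

/-- the whole test -/
def certOK (p : ℕ → ℚ × ℚ → ℚ × ℚ) (R l a d n : ℕ) (C : List ((ℚ × ℚ) × ℕ) × ℕ) : Bool :=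
  (C.1.all fun e => nearOK p R l a d n e) && (decide (n + 2 ≤ C.2) &&
    allLt (fun i => ptOK p R l n C.1 C.2 i) ((2 * R * 2 ^ (l * C.2 + 1 + 1) + 1) ^ 2))

theorem cPtOK {p : ℕ → ℚ × ℚ → ℚ × ℚ} (hp : Computable₂ p) (R l : ℕ) {n m i : α → ℕ}
    {L : α → List ((ℚ × ℚ) × ℕ)} (hn : Computable n) (hL : Computable L) (hm : Computable m)
    (hi : Computable i) : Computable fun x => ptOK p R l (n x) (L x) (m x) (i x) := by
  have h1 : Computable fun x => l * m x + 1 :=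
    Computable.succ.comp (cNatMul (Computable.const l) hm)
  have h2 : Computable fun x => gridPt R (l * m x + 1) (i x) := cGridPt R h1 hi
  have h3 : Computable fun y : α × ((ℚ × ℚ) × ℕ) => gridPt R (l * m y.1 + 1) (i y.1) :=
    h2.comp Computable.fst
  have h4 : Computable fun y : α × ((ℚ × ℚ) × ℕ) => y.2.1 := Computable.fst.comp Computable.snd
  have h5 : Computable fun y : α × ((ℚ × ℚ) × ℕ) => n y.1 + 2 :=
    cNatAdd (hn.comp Computable.fst) (Computable.const 2)
  have h6 : Computable fun y : α × ((ℚ × ℚ) × ℕ) =>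
      nsq (qSub (gridPt R (l * m y.1 + 1) (i y.1)) y.2.1) := cNsq (cQSub h3 h4)
  have h7 : Computable fun y : α × ((ℚ × ℚ) × ℕ) => (1 / 4 : ℚ) ^ (n y.1 + 2) := cRatPow _ h5
  have h8 : Computable₂ fun (x : α) (e : (ℚ × ℚ) × ℕ) =>
      !(decide (nsq (qSub (gridPt R (l * m x + 1) (i x)) e.1) ≤ (1 / 4 : ℚ) ^ (n x + 2))) :=
    Computable₂.mk (cNot (cRatLe h6 h7))
  have h9 := cNot (cListAll hL h8)
  have h10 := cNot (cInD hp R h1 h2 hm)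
  exact cOr h10 h9

theorem cCertOK {p : ℕ → ℚ × ℚ → ℚ × ℚ} (hp : Computable₂ p) (R l a d : ℕ) :
    Computable₂ fun (n : ℕ) (C : List ((ℚ × ℚ) × ℕ) × ℕ) => certOK p R l a d n C := by
  apply Computable₂.mk
  have h1 : Computable fun x : ℕ × (List ((ℚ × ℚ) × ℕ) × ℕ) => x.2.1 :=
    Computable.fst.comp Computable.snd
  have h2 : Computable fun x : ℕ × (List ((ℚ × ℚ) × ℕ) × ℕ) => x.2.2 :=
    Computable.snd.comp Computable.snd
  have h3 : Computable fun x : ℕ × (List ((ℚ × ℚ) × ℕ) × ℕ) => x.1 := Computable.fst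
  have h5 : Computable fun x : ℕ × (List ((ℚ × ℚ) × ℕ) × ℕ) => l * x.2.2 + 1 + 1 :=
    cNatAdd (cNatAdd (cNatMul (Computable.const l) h2) (Computable.const 1)) (Computable.const 1)
  have h6 : Computable fun x : ℕ × (List ((ℚ × ℚ) × ℕ) × ℕ) => 2 ^ (l * x.2.2 + 1 + 1) :=
    cNatPow 2 h5
  have h4 : Computable fun x : ℕ × (List ((ℚ × ℚ) × ℕ) × ℕ) =>
      2 * R * 2 ^ (l * x.2.2 + 1 + 1) + 1 :=
    cNatAdd (cNatMul (Computable.const (2 * R)) h6) (Computable.const 1)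
  have h7 : Computable fun x : ℕ × (List ((ℚ × ℚ) × ℕ) × ℕ) =>
      (2 * R * 2 ^ (l * x.2.2 + 1 + 1) + 1) ^ 2 :=
    (cNatMul h4 h4).of_eq fun x => (sq _).symm
  have h8 : Computable₂ fun (x : ℕ × (List ((ℚ × ℚ) × ℕ) × ℕ)) (e : (ℚ × ℚ) × ℕ) =>
      nearOK p R l a d x.1 e :=
    Computable₂.mk (cNearOK hp R l a d (h3.comp Computable.fst) Computable.snd)
  have h9 : Computable₂ fun (x : ℕ × (List ((ℚ × ℚ) × ℕ) × ℕ)) (i : ℕ) =>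
      ptOK p R l x.1 x.2.1 x.2.2 i :=
    Computable₂.mk (cPtOK hp R l (h3.comp Computable.fst) (h1.comp Computable.fst)
      (h2.comp Computable.fst) Computable.snd)
  have h10 := cListAll h1 h8
  have h11 := cAllLt h7 h9
  have h12 := cNatLe (cNatAdd h3 (Computable.const 2)) h2
  exact cAnd h10 (cAnd h12 h11)

variable {f : ℂ → ℂ} {K : Set ℂ} {p : ℕ → ℚ × ℚ → ℚ × ℚ} {R l a d : ℕ}

theorem quarter_pow (s : ℕ) : ((1:ℚ) / 4) ^ s = ((1 / 2) ^ s) ^ 2 := by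
  rw [← pow_mul, mul_comm, pow_mul]; norm_num

theorem Sys.shadow (S : Sys f K p R l a d) (t : ℕ) (c : ℚ × ℚ) (z : ℂ)
    (h0 : ‖z - ratPoint c‖ ≤ (1 / 2) ^ t) (m : ℕ) (hm : l * m + 1 ≤ t)
    (hb : (∀ j ≤ m, ‖f^[j] z‖ ≤ (R:ℝ) + 1) ∨ (∀ j ≤ m, ‖ratPoint ((p t)^[j] c)‖ ≤ (R:ℝ) + 1)) :
    ∀ j ≤ m, ‖f^[j] z - ratPoint ((p t)^[j] c)‖ ≤ 2 * (2 ^ l) ^ j * (1 / 2) ^ t - (1 / 2) ^ t ∧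
      ‖f^[j] z - ratPoint ((p t)^[j] c)‖ ≤ 1 := by
  refine _root_.shadow f (R + 1) (2 ^ l) ((1 / 2) ^ t) ?_ (by positivity) S.lip
    (fun j => f^[j] z) (fun j => ratPoint ((p t)^[j] c)) ?_ ?_ h0 m ?_ ?_
  · exact le_self_pow₀ one_le_two (by have := S.hl; omega)
  · intro j; exact Function.iterate_succ_apply' _ _ _
  · intro j hj
    simp only [Function.iterate_succ_apply']
    exact S.app t _ hj
  · rw [← pow_mul]
    have : (2:ℝ) * 2 ^ (l * m) ≤ 2 ^ t := by
      rw [← pow_succ']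
      exact pow_le_pow_right₀ one_le_two hm
    calc (2:ℝ) * 2 ^ (l * m) * (1/2)^t ≤ 2 ^ t * (1/2)^t := by gcongr
      _ = 1 := by rw [← mul_pow]; norm_num
  · intro j hj
    rcases hb with h | h
    · exact Or.inl (h j hj)
    · exact Or.inr (h j hj)

theorem near_const (l k s : ℕ) :
    (2:ℝ) * (2 ^ l) ^ k * (1 / 2) ^ (l * k + 3 + s) = (1 / 2) ^ s / 4 := by
  have : (2:ℝ) ^ (l * k) * (1/2) ^ (l * k) = 1 := by rw [← mul_pow]; norm_num
  rw [← pow_mul, pow_add, pow_add]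
  linear_combination ((1:ℝ) / 2) ^ s / 4 * this

theorem Sys.near_sound (S : Sys f K p R l a d) (n : ℕ) (e : (ℚ × ℚ) × ℕ)
    (h : nearOK p R l a d n e = true) : ∃ r ∈ K, dist (ratPoint e.1) r < (1 / 2) ^ (n + 1) := by
  rw [nearOK, Bool.and_eq_true, inD_iff, decide_eq_true_iff, quarter_pow,
    nsq_le_iff _ _ (by positivity), ratPoint_qSub] at h
  set k := e.2 + 1 with hk
  set s := (a + (n + 1)) * d ^ k with hs
  set t := l * k + 3 + s with ht
  obtain ⟨h1, h2⟩ := h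
  refine S.near k (by omega) _ _ ?_
  have h3 := (S.shadow t e.1 (ratPoint e.1) (by simp) k (by omega) (Or.inr h1) k le_rfl).1
  have h4 := near_const l k s
  rw [← ht] at h4
  rw [h4] at h3
  push_cast at h2
  rw [pow_succ] at h2
  have h5 := norm_sub_le_norm_sub_add_norm_sub (f^[k] (ratPoint e.1)) (ratPoint ((p t)^[k] e.1))
    (ratPoint e.1)
  have : (0:ℝ) < (1/2)^t := by positivity
  have : (0:ℝ) < (1/2)^s := by positivity
  linarith

theorem exists_ratPoint_near (z : ℂ) (ε : ℝ) (hε : 0 < ε) : ∃ q : ℚ × ℚ, ‖z - ratPoint q‖ ≤ ε := by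
  obtain ⟨u, hu1, hu2⟩ := exists_rat_btwn (show z.re - ε / 2 < z.re by linarith)
  obtain ⟨v, hv1, hv2⟩ := exists_rat_btwn (show z.im - ε / 2 < z.im by linarith)
  refine ⟨(u, v), (Complex.norm_le_abs_re_add_abs_im _).trans ?_⟩
  simp only [ratPoint, Complex.sub_re, Complex.sub_im]
  rw [abs_of_pos (by linarith), abs_of_pos (by linarith)]
  linarith

theorem Sys.near_complete (S : Sys f K p R l a d) (n : ℕ) (z : ℂ) (hz : z ∈ K) (ε : ℝ)
    (hε : 0 < ε) : ∃ e, nearOK p R l a d n e = true ∧ dist z (ratPoint e.1) < ε := by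
  obtain ⟨k, hk0, r, hrK, hr, hzr⟩ := S.dense z hz (ε / 2) (half_pos hε)
  obtain ⟨k, rfl⟩ := Nat.exists_eq_succ_of_ne_zero hk0
  simp only [Nat.succ_eq_add_one] at *
  set s := (a + (n + 1)) * d ^ (k + 1) with hs
  set t := l * (k + 1) + 3 + s with ht
  obtain ⟨q, hq⟩ := exists_ratPoint_near r (min ((1/2) ^ t) (ε / 2)) (by positivity)
  have hq1 := hq.trans (min_le_left _ _)
  have hq2 := hq.trans (min_le_right _ _)
  have hsh := S.shadow t q r hq1 (k + 1) (by omega)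
    (Or.inl fun j _ => (S.bdd r hrK j).trans (by linarith))
  refine ⟨(q, k), ?_, ?_⟩
  · rw [nearOK, Bool.and_eq_true, inD_iff, decide_eq_true_iff, quarter_pow,
      nsq_le_iff _ _ (by positivity), ratPoint_qSub]
    simp only
    rw [← hs, ← ht]
    constructor
    · intro j hj
      have h1 := (hsh j hj).2
      have h2 := S.bdd r hrK j
      have h3 := norm_sub_norm_le (ratPoint ((p t)^[j] q)) (f^[j] r)
      rw [norm_sub_rev] at h3
      linarith
    · have h1 := (hsh (k + 1) le_rfl).1
      have h4 := near_const l (k + 1) s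
      rw [← ht] at h4
      rw [h4, hr, norm_sub_rev] at h1
      have h5 := norm_sub_le_norm_sub_add_norm_sub (ratPoint ((p t)^[k + 1] q)) r (ratPoint q)
      push_cast
      rw [pow_succ]
      have : (0:ℝ) < (1/2)^s := by positivity
      linarith
  · have := dist_triangle z r (ratPoint q)
    rw [dist_eq_norm r] at this
    simp only
    linarith

theorem Sys.far_complete (S : Sys f K p R l a d) (n : ℕ) (ε : ℝ) (hε : 0 < ε) :
    ∃ m, n ≤ m ∧ ∀ c, inD p R (l * m + 1) c m = true → ∃ z ∈ K, dist (ratPoint c) z < ε := by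
  have hT : IsCompact (Metric.closedBall (0:ℂ) (R + 1) ∩ (Metric.thickening ε K)ᶜ) :=
    (isCompact_closedBall _ _).inter_right Metric.isOpen_thickening.isClosed_compl
  obtain ⟨s, hs⟩ := hT.elim_finite_subcover (fun j : ℕ => {z : ℂ | (R:ℝ) + 2 < ‖f^[j] z‖})
    (fun j => isOpen_lt continuous_const (S.cont.iterate j).norm) (by
      intro z hz
      have hzK : z ∉ K := fun h => hz.2 (Metric.self_subset_thickening hε K h)
      exact mem_iUnion.2 (S.esc z hzK _))
  refine ⟨max n (s.sup id), le_max_left _ _, fun c hc => ?_⟩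
  set m := max n (s.sup id) with hm
  rw [inD_iff] at hc
  by_contra hcon
  have hcT : ratPoint c ∈ Metric.closedBall (0:ℂ) (R + 1) ∩ (Metric.thickening ε K)ᶜ := by
    refine ⟨?_, fun h => hcon (Metric.mem_thickening_iff.1 h)⟩
    rw [mem_closedBall_zero_iff]
    exact hc 0 (by omega)
  obtain ⟨j, hj, hjz⟩ := mem_iUnion₂.1 (hs hcT)
  have hjm : j ≤ m := (Finset.le_sup (f := id) hj).trans (le_max_right _ _)
  have h1 := (S.shadow (l * m + 1) c (ratPoint c) (by simp) m le_rfl (Or.inr hc) j hjm).2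
  have h2 := hc j hjm
  have h3 := norm_sub_norm_le (f^[j] (ratPoint c)) (ratPoint ((p (l * m + 1))^[j] c))
  have h4 : (R:ℝ) + 2 < ‖f^[j] (ratPoint c)‖ := hjz
  linarith

theorem ptOK_iff (n : ℕ) (L : List ((ℚ × ℚ) × ℕ)) (m i : ℕ) : ptOK p R l n L m i = true ↔
    (inD p R (l * m + 1) (gridPt R (l * m + 1) i) m = true →
      ∃ e ∈ L, dist (ratPoint (gridPt R (l * m + 1) i)) (ratPoint e.1) ≤ (1 / 2) ^ (n + 2)) := by
  have key : ∀ e : (ℚ × ℚ) × ℕ, nsq (qSub (gridPt R (l * m + 1) i) e.1) ≤ (1 / 4 : ℚ) ^ (n + 2) ↔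
      dist (ratPoint (gridPt R (l * m + 1) i)) (ratPoint e.1) ≤ (1 / 2) ^ (n + 2) := by
    intro e
    rw [quarter_pow, nsq_le_iff _ _ (by positivity), ratPoint_qSub, dist_eq_norm]
    push_cast
    rfl
  simp only [← key]
  rw [ptOK]
  simp only [Bool.or_eq_true, Bool.not_eq_true', List.all_eq_false, Bool.not_eq_false,
    decide_eq_true_eq]
  rw [imp_iff_not_or, Bool.not_eq_true]

theorem Sys.complete (S : Sys f K p R l a d) (n : ℕ) : ∃ C, certOK p R l a d n C = true := by
  set η : ℝ := (1 / 2) ^ (n + 2) with hη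
  have hη0 : 0 < η := by positivity
  obtain ⟨s, hs⟩ := S.compact.elim_finite_subcover
    (fun e : {e : (ℚ × ℚ) × ℕ // nearOK p R l a d n e = true} =>
      Metric.ball (ratPoint e.1.1) (η / 2)) (fun _ => Metric.isOpen_ball) (by
      intro z hz
      obtain ⟨e, he, hze⟩ := S.near_complete n z hz (η / 2) (half_pos hη0)
      exact mem_iUnion.2 ⟨⟨e, he⟩, hze⟩)
  obtain ⟨m, hm, hfar⟩ := S.far_complete (n + 2) (η / 2) (half_pos hη0)
  refine ⟨(s.toList.map Subtype.val, m), ?_⟩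
  rw [certOK, Bool.and_eq_true, Bool.and_eq_true, List.all_eq_true, decide_eq_true_iff, allLt_iff]
  refine ⟨?_, hm, ?_⟩
  · intro e he
    obtain ⟨e', _, rfl⟩ := List.mem_map.1 he
    exact e'.2
  · intro i _
    rw [ptOK_iff]
    intro hin
    obtain ⟨z, hz, hcz⟩ := hfar _ hin
    obtain ⟨e, he, hze⟩ := mem_iUnion₂.1 (hs hz)
    refine ⟨e.1, List.mem_map.2 ⟨e, by simpa using he, rfl⟩, ?_⟩
    rw [mem_ball] at hze
    have := dist_triangle (ratPoint (gridPt R (l * m + 1) i)) z (ratPoint e.1.1)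
    linarith

theorem Sys.sound (S : Sys f K p R l a d) (n : ℕ) (C : List ((ℚ × ℚ) × ℕ) × ℕ)
    (hC : certOK p R l a d n C = true) :
    (∀ e ∈ C.1, ∃ r ∈ K, dist (ratPoint e.1) r ≤ (1 / 2) ^ (n + 1)) ∧
    ∀ z ∈ K, ∃ e ∈ C.1, dist z (ratPoint e.1) ≤ (1 / 2) ^ (n + 1) := by
  rw [certOK, Bool.and_eq_true, Bool.and_eq_true, List.all_eq_true, decide_eq_true_iff,
    allLt_iff] at hC
  obtain ⟨h1, h2, h3⟩ := hC
  constructor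
  · intro e he
    obtain ⟨r, hr, hr'⟩ := S.near_sound n e (h1 e he)
    exact ⟨r, hr, hr'.le⟩
  · intro z hz
    obtain ⟨i, hi, hzi⟩ := grid_exists R (l * C.2 + 1) z (S.bdd z hz 0)
    have hin : inD p R (l * C.2 + 1) (gridPt R (l * C.2 + 1) i) C.2 = true := by
      rw [inD_iff]
      intro j hj
      have h5 := (S.shadow _ _ z hzi C.2 le_rfl
        (Or.inl fun j _ => (S.bdd z hz j).trans (by linarith)) j hj).2
      have h6 := S.bdd z hz j
      have h7 := norm_sub_norm_le (ratPoint ((p (l * C.2 + 1))^[j] (gridPt R (l * C.2 + 1) i)))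
        (f^[j] z)
      rw [norm_sub_rev] at h7
      linarith
    obtain ⟨e, he, hd⟩ := (ptOK_iff n C.1 C.2 i).1 (h3 i hi) hin
    refine ⟨e, he, ?_⟩
    have h8 := dist_triangle z (ratPoint (gridPt R (l * C.2 + 1) i)) (ratPoint e.1)
    have h9 : ((1:ℝ)/2) ^ (l * C.2 + 1) ≤ (1/2) ^ (n + 2) := by
      refine pow_le_pow_of_le_one (by norm_num) (by norm_num) ?_
      have := Nat.mul_le_mul S.hl (le_refl C.2)
      omega
    rw [← dist_eq_norm] at hzi
    have h10 : ((1:ℝ)/2) ^ (n + 1) = (1/2)^(n+2) + (1/2)^(n+2) := by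
      rw [pow_succ _ (n+1)]; ring
    linarith

theorem Sys.computable (S : Sys f K p R l a d) : ComputableCompactSet K := by
  obtain ⟨F, hF, hF'⟩ := exists_computable_choose _ (cCertOK S.cp R l a d) S.complete
  refine ⟨fun n => (F n).1.map Prod.fst, ?_, fun n => ?_⟩
  · have hmap : Computable fun L : List ((ℚ × ℚ) × ℕ) => L.map Prod.fst :=
      (Primrec.list_map Primrec.id (Primrec.fst.comp Primrec.snd).to₂).to_comp
    exact hmap.comp (Computable.fst.comp hF)
  · obtain ⟨s1, s2⟩ := S.sound n (F n) (hF' n)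
    obtain ⟨z, hz⟩ := S.nonempty
    constructor
    · refine iff_of_false ?_ S.nonempty.ne_empty
      obtain ⟨e, he, _⟩ := s2 z hz
      intro h0
      rw [List.map_eq_nil_iff] at h0
      rw [h0] at he
      exact absurd he List.not_mem_nil
    · refine lt_of_le_of_lt (Metric.hausdorffDist_le_of_mem_dist
        (r := (1 / 2) ^ (n + 1)) (by positivity) ?_ ?_) ?_
      · rintro _ ⟨q, hq, rfl⟩
        obtain ⟨e, he, rfl⟩ := List.mem_map.1 hq
        exact s1 e he
      · intro x hx
        obtain ⟨e, he, hd⟩ := s2 x hx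
        exact ⟨_, ⟨e.1, List.mem_map.2 ⟨e, he, rfl⟩, rfl⟩, hd⟩
      · exact pow_lt_pow_right_of_lt_one₀ (by norm_num) (by norm_num) (by omega)

end PartD

theorem exists_sys (P : Polynomial ℂ) (hdeg : 2 ≤ P.natDegree)
    (hP : ∀ i : ℕ, ComputableComplex (P.coeff i))
    (hint : interior (filledJulia (fun z : ℂ => P.eval z)) = ∅) :
    ∃ p R l a d, Sys (fun z : ℂ => P.eval z) (filledJulia (fun z : ℂ => P.eval z)) p R l a d := by
  obtain ⟨b, R, hE⟩ := exists_escape P hdeg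
  obtain ⟨l, hl, hlip⟩ := exists_lip P ((R:ℝ) + 1 + 1)
  obtain ⟨p, hp, hp'⟩ := CApprox.poly (R + 1 + 1) P.natDegree P le_rfl hP
  have hlc : 0 < ‖P.leadingCoeff‖ := by
    rw [norm_pos_iff, Ne, leadingCoeff_eq_zero]
    rintro rfl
    simp at hdeg
  obtain ⟨a, ha⟩ := exists_pow_lt_of_lt_one hlc (show (1:ℝ) / 2 < 1 by norm_num)
  refine ⟨p, R, l, a, P.natDegree, hp, P.continuous, hl, hlip, ?_, ?_, ?_, ?_, ?_,
    hE.isCompact hdeg, filledJulia_nonempty P hdeg⟩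
  · intro t w hw
    exact hp' t w (by push_cast; exact hw)
  · intro z hz n
    exact (hE.norm_lt hdeg hz n).le
  · intro z hz A
    exact exists_norm_gt hz A
  · intro n hn c k h
    obtain ⟨r, hr, hd⟩ := exists_periodic_of_small P hdeg ((1 / 2) ^ a) (by positivity)
      (pow_le_one₀ (by norm_num) (by norm_num)) ha.le n hn c ((1 / 2) ^ k) (by positivity) (by
        rw [← pow_add, ← pow_mul]; exact h)
    exact ⟨r, periodic_mem_filledJulia _ n hn r hr, hd⟩
  · intro z hz ε hε
    obtain ⟨n, hn, r, hr, hd⟩ := periodic_dense hdeg hint z hz ε hε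
    exact ⟨n, hn, r, periodic_mem_filledJulia _ n hn r hr, hr, hd⟩

/-- If `P` is a computable polynomial of degree ≥ 2 whose filled Julia set has
empty interior, then `J(P) = K(P)` and the Julia set is a computable compact set. -/
theorem juliaSet_computable_of_empty_interior (P : Polynomial ℂ) (hdeg : 2 ≤ P.natDegree)
    (hP : ∀ i : ℕ, ComputableComplex (P.coeff i))
    (hint : interior (filledJulia (fun z : ℂ => P.eval z)) = ∅) :
    juliaSet (fun z : ℂ => P.eval z) = filledJulia (fun z : ℂ => P.eval z) ∧
    IsCompact (juliaSet (fun z : ℂ => P.eval z)) ∧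
    ComputableCompactSet (juliaSet (fun z : ℂ => P.eval z)) := by
  obtain ⟨p, R, l, a, d, S⟩ := exists_sys P hdeg hP hint
  have h : juliaSet (fun z : ℂ => P.eval z) = filledJulia (fun z : ℂ => P.eval z) := by
    rw [juliaSet, S.compact.isClosed.frontier_eq, hint, Set.sdiff_empty]
  refine ⟨h, ?_, ?_⟩
  · rw [h]; exact S.compact
  · rw [h]; exact S.computable
end
end

section
/- Let K ⊆ ℂ be a computable compact set. Then the covering relation by finite lists of rational balls is semi-decidable: there exists a partial computable function defined on (codes of) finite lists of rational balls which halts on a list L if and only if K is contained in the union of the balls in L. -/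
open Complex Metric Set Filter Polynomial

noncomputable section

open Encodable in
/-- The basic code (numerator code paired with denominator) of a rational. -/
def ratRaw (q : ℚ) : ℕ := Nat.pair (encode q.num) q.den

/-- positive part of the integer coded by `c` -/
def intPos (c : ℕ) : ℕ := if c % 2 = 0 then c / 2 else 0

/-- negative part of the integer coded by `c` -/
def intNeg (c : ℕ) : ℕ := if c % 2 = 0 then 0 else c / 2 + 1

theorem encode_int_ofNat (n : ℕ) : Encodable.encode (Int.ofNat n) = 2 * n := rfl

theorem encode_int_negSucc (n : ℕ) : Encodable.encode (Int.negSucc n) = 2 * n + 1 := rfl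

theorem intPos_sub_intNeg (z : ℤ) :
    (intPos (Encodable.encode z) : ℤ) - intNeg (Encodable.encode z) = z := by
  cases z with
  | ofNat n => rw [encode_int_ofNat]; simp [intPos, intNeg]
  | negSucc n =>
    rw [encode_int_negSucc]
    have h1 : (2 * n + 1) % 2 = 1 := by omega
    have h2 : (2 * n + 1) / 2 = n := by omega
    simp only [intPos, intNeg, h1, h2, one_ne_zero, if_false]
    omega

theorem natAbs_eq_intPos_add (z : ℤ) :
    intPos (Encodable.encode z) + intNeg (Encodable.encode z) = z.natAbs := by
  cases z with
  | ofNat n => rw [encode_int_ofNat]; simp [intPos, intNeg]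
  | negSucc n =>
    rw [encode_int_negSucc]
    have h1 : (2 * n + 1) % 2 = 1 := by omega
    have h2 : (2 * n + 1) / 2 = n := by omega
    simp only [intPos, intNeg, h1, h2, one_ne_zero, if_false]
    omega

theorem primrec_intPos : Primrec intPos :=
  Primrec.ite (Primrec.eq.comp (Primrec.nat_mod.comp Primrec.id (Primrec.const 2))
    (Primrec.const 0)) (Primrec.nat_div.comp Primrec.id (Primrec.const 2)) (Primrec.const 0)

theorem primrec_intNeg : Primrec intNeg :=
  Primrec.ite (Primrec.eq.comp (Primrec.nat_mod.comp Primrec.id (Primrec.const 2))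
    (Primrec.const 0)) (Primrec.const 0)
    (Primrec.succ.comp (Primrec.nat_div.comp Primrec.id (Primrec.const 2)))

/-- The set of basic codes, explicitly. -/
def RawCode (m : ℕ) : Prop :=
  0 < m.unpair.2 ∧ ∀ k < m.unpair.2 + 1,
    ¬ (2 ≤ k ∧ (intPos m.unpair.1 + intNeg m.unpair.1) % k = 0 ∧ m.unpair.2 % k = 0)

theorem coprime_iff_forall_lt (a b : ℕ) (hb : 0 < b) :
    Nat.Coprime a b ↔ ∀ k < b + 1, ¬ (2 ≤ k ∧ a % k = 0 ∧ b % k = 0) := by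
  constructor
  · rintro h k - ⟨h2, h3, h4⟩
    have := Nat.eq_one_of_dvd_coprimes h (Nat.dvd_of_mod_eq_zero h3) (Nat.dvd_of_mod_eq_zero h4)
    omega
  · intro h
    by_contra hc
    have hg : 0 < Nat.gcd a b := Nat.gcd_pos_of_pos_right _ hb
    have hc' : Nat.gcd a b ≠ 1 := hc
    exact h (Nat.gcd a b) (Nat.lt_succ_of_le (Nat.gcd_le_right _ hb))
      ⟨by omega, Nat.mod_eq_zero_of_dvd (Nat.gcd_dvd_left a b),
        Nat.mod_eq_zero_of_dvd (Nat.gcd_dvd_right a b)⟩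

theorem primrecPred_rawCode : PrimrecPred RawCode := by
  have u1 : Primrec fun m : ℕ => m.unpair.1 := Primrec.fst.comp Primrec.unpair
  have u2 : Primrec fun m : ℕ => m.unpair.2 := Primrec.snd.comp Primrec.unpair
  have ab : Primrec fun m : ℕ => intPos m.unpair.1 + intNeg m.unpair.1 :=
    Primrec.nat_add.comp (primrec_intPos.comp u1) (primrec_intNeg.comp u1)
  have hR : PrimrecRel fun (k m : ℕ) =>
      ¬ (2 ≤ k ∧ (intPos m.unpair.1 + intNeg m.unpair.1) % k = 0 ∧ m.unpair.2 % k = 0) := by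
    apply PrimrecRel.not
    apply PrimrecPred.primrecRel
      (p := fun x : ℕ × ℕ => 2 ≤ x.1 ∧ (intPos x.2.unpair.1 + intNeg x.2.unpair.1) % x.1 = 0 ∧
        x.2.unpair.2 % x.1 = 0)
    refine PrimrecPred.and (Primrec.nat_le.comp (Primrec.const 2) Primrec.fst)
      (PrimrecPred.and (Primrec.eq.comp (Primrec.nat_mod.comp (ab.comp Primrec.snd) Primrec.fst)
        (Primrec.const 0)) (Primrec.eq.comp (Primrec.nat_mod.comp (u2.comp Primrec.snd) Primrec.fst)
        (Primrec.const 0)))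
  exact PrimrecPred.and (Primrec.nat_lt.comp (Primrec.const 0) u2)
    ((hR.forall_lt).comp (Primrec.succ.comp u2) Primrec.id)

theorem rawCode_iff (m : ℕ) : RawCode m ↔ ∃ q : ℚ, ratRaw q = m := by
  constructor
  · rintro ⟨h0, h⟩
    rw [← coprime_iff_forall_lt _ _ h0] at h
    have hz : Encodable.encode (Denumerable.ofNat ℤ m.unpair.1) = m.unpair.1 :=
      Denumerable.encode_ofNat _
    have h1 := natAbs_eq_intPos_add (Denumerable.ofNat ℤ m.unpair.1)
    rw [hz] at h1
    rw [h1] at h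
    refine ⟨⟨Denumerable.ofNat ℤ m.unpair.1, m.unpair.2, h0.ne', h⟩, ?_⟩
    show Nat.pair (Encodable.encode (Denumerable.ofNat ℤ m.unpair.1)) m.unpair.2 = m
    rw [hz, Nat.pair_unpair]
  · rintro ⟨q, rfl⟩
    simp only [RawCode, ratRaw, Nat.unpair_pair]
    refine ⟨q.pos, (coprime_iff_forall_lt _ _ q.pos).1 ?_⟩
    rw [natAbs_eq_intPos_add]
    exact q.reduced

theorem ratRaw_eq (q : ℚ) :
    @Encodable.encode ℚ Rat.instEncodable q = ratRaw q := rfl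

/-- The increasing enumeration of basic codes. -/
def rawEnum (n : ℕ) : ℕ := ratRaw (Denumerable.ofNat ℚ n)

theorem rawEnum_spec : ∃ (s : Set ℕ) (_ : DecidablePred (· ∈ s)) (_ : Infinite s),
    s = Set.range ratRaw ∧ ∀ n, rawEnum n = (Nat.Subtype.ofNat s n : ℕ) := by
  refine ⟨Set.range (@Encodable.encode ℚ Rat.instEncodable),
    @Encodable.decidableRangeEncode ℚ _,
    Infinite.of_injective _ (Equiv.ofInjective _ Encodable.encode_injective).injective, rfl, ?_⟩
  intro n
  let := @Encodable.decidableRangeEncode ℚ Rat.instEncodable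
  let : Infinite (Set.range (@Encodable.encode ℚ Rat.instEncodable)) :=
    Infinite.of_injective _ (Equiv.ofInjective _ Encodable.encode_injective).injective
  let D := Nat.Subtype.denumerable (Set.range (@Encodable.encode ℚ Rat.instEncodable))
  have h1 : Denumerable.ofNat ℚ n =
      (@Encodable.equivRangeEncode ℚ Rat.instEncodable).symm
        (Nat.Subtype.ofNat (Set.range (@Encodable.encode ℚ Rat.instEncodable)) n) := rfl
  rw [rawEnum, h1, ← ratRaw_eq]
  exact congrArg Subtype.val
    ((@Encodable.equivRangeEncode ℚ Rat.instEncodable).apply_symm_apply _)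

theorem exists_rawCode_gt (x : ℕ) : ∃ m, RawCode (x + m + 1) := by
  obtain ⟨s, hd, hi, rfl, -⟩ := rawEnum_spec
  obtain ⟨y, hy, hxy⟩ := (Set.infinite_coe_iff.1 hi).exists_gt x
  exact ⟨y - x - 1, (rawCode_iff _).2 (by rwa [show x + (y - x - 1) + 1 = y by omega])⟩

theorem computable_rawEnum : Computable rawEnum := by
  classical
  have hf : Computable fun x => Nat.find (exists_rawCode_gt x) := by
    refine Computable.find (P := fun x m => RawCode (x + m + 1)) ?_ exists_rawCode_gt
    exact (primrecPred_rawCode.comp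
      (Primrec.succ.comp (Primrec.nat_add.comp Primrec.fst Primrec.snd))).computablePred
  have hstep : Computable fun x => x + Nat.find (exists_rawCode_gt x) + 1 :=
    Computable.succ.comp ((Primrec.nat_add.to_comp).comp Computable.id hf)
  have hrec : Computable fun n : ℕ => Nat.rec (motive := fun _ => ℕ) (rawEnum 0)
      (fun _ x => x + Nat.find (exists_rawCode_gt x) + 1) n :=
    Computable.nat_rec Computable.id (Computable.const _)
      ((hstep.comp (Computable.snd.comp Computable.snd)).to₂ : Computable₂ fun (_ : ℕ)
        (p : ℕ × ℕ) => p.2 + Nat.find (exists_rawCode_gt p.2) + 1)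
  refine hrec.of_eq fun n => ?_
  obtain ⟨s, hd, hi, hs, h⟩ := rawEnum_spec
  induction n with
  | zero => rfl
  | succ n ih =>
    simp only [] at ih ⊢
    rw [ih, h (n + 1), h n]
    simp only [Nat.Subtype.ofNat, Nat.Subtype.succ]
    have : ∀ m, m ∈ s ↔ RawCode m := fun m => by rw [hs, rawCode_iff]; rfl
    congr 2
    apply Nat.find_congr'
    intro k
    exact (this _).symm

theorem computable_ratRaw : Computable ratRaw :=
  (computable_rawEnum.comp Computable.encode).of_eq fun q =>
    congrArg ratRaw (Denumerable.ofNat_encode q)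

/-- `f` is a rational-valued function whose values are computably represented as `(a - b) / d`. -/
def RepComp {α : Type*} [Primcodable α] (f : α → ℚ) : Prop :=
  ∃ a b d : α → ℕ, Computable a ∧ Computable b ∧ Computable d ∧
    ∀ x, 0 < d x ∧ f x = ((a x : ℚ) - b x) / d x

section Rep

variable {α : Type*} [Primcodable α]

theorem comp_add {f g : α → ℕ} (hf : Computable f) (hg : Computable g) :
    Computable fun x => f x + g x := Primrec.nat_add.to_comp.comp hf hg

theorem comp_mul {f g : α → ℕ} (hf : Computable f) (hg : Computable g) :
    Computable fun x => f x * g x := Primrec.nat_mul.to_comp.comp hf hg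

theorem RepComp.of_computable {f : α → ℚ} (hf : Computable f) : RepComp f := by
  have hr : Computable fun x => (ratRaw (f x)).unpair := Computable.unpair.comp
    (computable_ratRaw.comp hf)
  refine ⟨fun x => intPos (ratRaw (f x)).unpair.1, fun x => intNeg (ratRaw (f x)).unpair.1,
    fun x => (ratRaw (f x)).unpair.2, primrec_intPos.to_comp.comp (Computable.fst.comp hr),
    primrec_intNeg.to_comp.comp (Computable.fst.comp hr), Computable.snd.comp hr, fun x => ?_⟩
  simp only [ratRaw, Nat.unpair_pair]
  refine ⟨(f x).pos, ?_⟩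
  have h : ((intPos (Encodable.encode (f x).num) : ℤ) : ℚ) -
      ((intNeg (Encodable.encode (f x).num) : ℤ) : ℚ) = (f x).num := by
    rw [← Int.cast_sub, intPos_sub_intNeg]
  simp only [Int.cast_natCast] at h
  rw [h, Rat.num_div_den]

theorem RepComp.add {f g : α → ℚ} (hf : RepComp f) (hg : RepComp g) :
    RepComp fun x => f x + g x := by
  obtain ⟨a, b, d, ha, hb, hd, h⟩ := hf
  obtain ⟨a', b', d', ha', hb', hd', h'⟩ := hg
  refine ⟨fun x => a x * d' x + a' x * d x, fun x => b x * d' x + b' x * d x, fun x => d x * d' x,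
    comp_add (comp_mul ha hd') (comp_mul ha' hd), comp_add (comp_mul hb hd') (comp_mul hb' hd),
    comp_mul hd hd', fun x => ?_⟩
  obtain ⟨h1, h2⟩ := h x
  obtain ⟨h1', h2'⟩ := h' x
  refine ⟨Nat.mul_pos h1 h1', ?_⟩
  have e1 : (d x : ℚ) ≠ 0 := by exact_mod_cast h1.ne'
  have e2 : (d' x : ℚ) ≠ 0 := by exact_mod_cast h1'.ne'
  simp only [h2, h2']
  push_cast
  field_simp
  ring

theorem RepComp.neg {f : α → ℚ} (hf : RepComp f) : RepComp fun x => - f x := by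
  obtain ⟨a, b, d, ha, hb, hd, h⟩ := hf
  refine ⟨b, a, d, hb, ha, hd, fun x => ⟨(h x).1, ?_⟩⟩
  simp only [(h x).2]
  ring

theorem RepComp.sub {f g : α → ℚ} (hf : RepComp f) (hg : RepComp g) :
    RepComp fun x => f x - g x := by
  simpa only [sub_eq_add_neg] using hf.add hg.neg

theorem RepComp.mul {f g : α → ℚ} (hf : RepComp f) (hg : RepComp g) :
    RepComp fun x => f x * g x := by
  obtain ⟨a, b, d, ha, hb, hd, h⟩ := hf
  obtain ⟨a', b', d', ha', hb', hd', h'⟩ := hg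
  refine ⟨fun x => a x * a' x + b x * b' x, fun x => a x * b' x + b x * a' x, fun x => d x * d' x,
    comp_add (comp_mul ha ha') (comp_mul hb hb'), comp_add (comp_mul ha hb') (comp_mul hb ha'),
    comp_mul hd hd', fun x => ?_⟩
  obtain ⟨h1, h2⟩ := h x
  obtain ⟨h1', h2'⟩ := h' x
  refine ⟨Nat.mul_pos h1 h1', ?_⟩
  have e1 : (d x : ℚ) ≠ 0 := by exact_mod_cast h1.ne'
  have e2 : (d' x : ℚ) ≠ 0 := by exact_mod_cast h1'.ne'
  simp only [h2, h2']
  push_cast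
  field_simp
  ring

theorem RepComp.half_pow {n : α → ℕ} (hn : Computable n) :
    RepComp fun x => (1 / 2 : ℚ) ^ n x := by
  have hp : Primrec₂ fun a b : ℕ => a ^ b := Primrec₂.unpaired'.1 Nat.Primrec.pow
  refine ⟨fun _ => 1, fun _ => 0, fun x => 2 ^ n x, Computable.const _, Computable.const _,
    hp.to_comp.comp (Computable.const 2) hn, fun x => ⟨by positivity, ?_⟩⟩
  simp

theorem RepComp.lt {f g : α → ℚ} (hf : RepComp f) (hg : RepComp g) :
    Computable fun x => decide (f x < g x) := by
  obtain ⟨a, b, d, ha, hb, hd, h⟩ := hf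
  obtain ⟨a', b', d', ha', hb', hd', h'⟩ := hg
  have : Computable fun x => decide (a x * d' x + b' x * d x < a' x * d x + b x * d' x) :=
    Primrec.nat_lt.decide.to_comp.comp (comp_add (comp_mul ha hd') (comp_mul hb' hd))
      (comp_add (comp_mul ha' hd) (comp_mul hb hd'))
  refine this.of_eq fun x => ?_
  obtain ⟨h1, h2⟩ := h x
  obtain ⟨h1', h2'⟩ := h' x
  have e1 : (0 : ℚ) < d x := by exact_mod_cast h1
  have e2 : (0 : ℚ) < d' x := by exact_mod_cast h1'
  rw [decide_eq_decide, h2, h2', div_lt_div_iff₀ e1 e2, ← Nat.cast_lt (α := ℚ)]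
  push_cast
  constructor <;> intro h <;> nlinarith

theorem computable_all {β : Type*} [Primcodable β] {l : α → List β} {p : α × β → Bool}
    (hl : Computable l) (hp : Computable p) :
    Computable fun x => (l x).all fun b => p (x, b) := by
  have hc : Computable fun x : α => Nat.rec (motive := fun _ => Bool) true
      (fun i acc => acc && (Option.casesOn ((l x)[i]?) true fun b => p (x, b) : Bool))
      (l x).length := by
    refine Computable.nat_rec (f := fun x => (l x).length) (g := fun _ => true)
      (h := fun x (r : ℕ × Bool) =>
        r.2 && (Option.casesOn ((l x)[r.1]?) true fun b => p (x, b) : Bool))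
      (Computable.list_length.comp hl) (Computable.const true) ?_
    refine Primrec.and.to_comp.comp (Computable.snd.comp Computable.snd) ?_
    exact Computable.option_casesOn
      (Computable.list_getElem?.comp (hl.comp Computable.fst)
        (Computable.fst.comp Computable.snd)) (Computable.const true)
      (hp.comp (Computable.pair (Computable.fst.comp Computable.fst) Computable.snd)).to₂
  refine hc.of_eq fun x => ?_
  have key : ∀ n ≤ (l x).length, (Nat.rec (motive := fun _ => Bool) true
      (fun i acc => acc && (Option.casesOn ((l x)[i]?) true fun b => p (x, b) : Bool))
      n : Bool) = ((l x).take n).all fun b => p (x, b) := by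
    intro n
    induction n with
    | zero => intro _; simp
    | succ n ih =>
      intro hn
      have hn' : n < (l x).length := hn
      simp only [ih hn'.le, List.take_add_one, List.getElem?_eq_getElem hn', List.all_append]
      simp
  rw [key _ le_rfl, List.take_length]

theorem computable_any {β : Type*} [Primcodable β] {l : α → List β} {p : α × β → Bool}
    (hl : Computable l) (hp : Computable p) :
    Computable fun x => (l x).any fun b => p (x, b) :=
  (Primrec.not.to_comp.comp (computable_all hl (Primrec.not.to_comp.comp hp))).of_eq fun x => by
    simp [List.any_eq_not_all_not]

end Rep

/-- The decidable test: `q` lies in the ball `c` with margin `2⁻ⁿ`. -/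
def ballTest (n : ℕ) (q : ℚ × ℚ) (c : ℚ × ℚ × ℚ) : Bool :=
  decide (0 < c.2.2 - (1 / 2) ^ n) &&
  decide ((q.1 - c.1) * (q.1 - c.1) + (q.2 - c.2.1) * (q.2 - c.2.1) <
    (c.2.2 - (1 / 2) ^ n) * (c.2.2 - (1 / 2) ^ n))

theorem ballTest_iff (n : ℕ) (q : ℚ × ℚ) (c : ℚ × ℚ × ℚ) :
    ballTest n q c = true ↔
      dist (ratPoint q) (ratPoint (c.1, c.2.1)) < (c.2.2 : ℝ) - (1 / 2) ^ n := by
  have hd : dist (ratPoint q) (ratPoint (c.1, c.2.1)) =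
      Real.sqrt (((q.1 : ℝ) - c.1) ^ 2 + ((q.2 : ℝ) - c.2.1) ^ 2) := by
    rw [Complex.dist_eq_re_im]; rfl
  rw [ballTest, Bool.and_eq_true, decide_eq_true_iff, decide_eq_true_iff, hd,
    ← Rat.cast_lt (K := ℝ), ← Rat.cast_lt (K := ℝ)]
  push_cast
  constructor
  · rintro ⟨h1, h2⟩
    rw [Real.sqrt_lt' h1]
    nlinarith
  · intro h
    have h1 := (Real.sqrt_nonneg _).trans_lt h
    rw [Real.sqrt_lt' h1] at h
    exact ⟨h1, by nlinarith⟩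

theorem computable_ballTest {α : Type*} [Primcodable α] {n : α → ℕ} {q : α → ℚ × ℚ}
    {c : α → ℚ × ℚ × ℚ} (hn : Computable n) (hq : Computable q) (hc : Computable c) :
    Computable fun x => ballTest (n x) (q x) (c x) := by
  have q1 := RepComp.of_computable (Computable.fst.comp hq)
  have q2 := RepComp.of_computable (Computable.snd.comp hq)
  have c1 := RepComp.of_computable (Computable.fst.comp hc)
  have c2 := RepComp.of_computable (Computable.fst.comp (Computable.snd.comp hc))
  have c3 := RepComp.of_computable (Computable.snd.comp (Computable.snd.comp hc))
  have r := c3.sub (RepComp.half_pow hn)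
  have z : RepComp fun _ : α => (0 : ℚ) := RepComp.of_computable (Computable.const 0)
  have h1 := z.lt r
  have h2 := (((q1.sub c1).mul (q1.sub c1)).add ((q2.sub c2).mul (q2.sub c2))).lt (r.mul r)
  exact Primrec.and.to_comp.comp h1 h2

theorem cover_iff {K : Set ℂ} (hK : IsCompact K) {C : ℕ → List (ℚ × ℚ)}
    (hC : ∀ n : ℕ, (C n = [] ↔ K = ∅) ∧
      Metric.hausdorffDist (ratPoint '' {q | q ∈ C n}) K < (1 / 2) ^ n)
    (L : List (ℚ × ℚ × ℚ)) :
    (∃ n, ∀ q ∈ C n, ∃ c ∈ L, ballTest n q c = true) ↔ K ⊆ ⋃ b ∈ L, ratBall b := by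
  rcases K.eq_empty_or_nonempty with hE | hE
  · have h0 := (hC 0).1.2 hE
    simp only [hE, Set.empty_subset, iff_true]
    exact ⟨0, by simp [h0]⟩
  have fin : ∀ n, Metric.hausdorffEDist (ratPoint '' {q | q ∈ C n}) K ≠ ⊤ := fun n => by
    refine Metric.hausdorffEDist_ne_top_of_nonempty_of_bounded ?_ hE
      ((List.finite_toSet (C n)).image _).isBounded hK.isBounded
    apply Set.Nonempty.image
    exact List.exists_mem_of_ne_nil _ fun h => hE.ne_empty ((hC n).1.1 h)
  constructor
  · rintro ⟨n, h⟩ x hx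
    obtain ⟨_, ⟨q, hq, rfl⟩, hd⟩ :=
      Metric.exists_dist_lt_of_hausdorffDist_lt' hx (hC n).2 (fin n)
    obtain ⟨c, hc, ht⟩ := h q hq
    rw [ballTest_iff] at ht
    simp only [Set.mem_iUnion]
    refine ⟨c, hc, ?_⟩
    rw [ratBall, Metric.mem_ball]
    have := dist_triangle_left x (ratPoint (c.1, c.2.1)) (ratPoint q)
    linarith
  · intro h
    obtain ⟨m, hm⟩ := hK.elim_directed_cover
      (fun m : ℕ => ⋃ b ∈ L, Metric.ball (ratPoint (b.1, b.2.1)) ((b.2.2 : ℝ) - (1 / 2) ^ m))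
      (fun m => isOpen_biUnion fun b _ => Metric.isOpen_ball)
      (by
        intro x hx
        have := h hx
        simp only [Set.mem_iUnion] at this ⊢
        obtain ⟨b, hb, hxb⟩ := this
        rw [ratBall, Metric.mem_ball] at hxb
        obtain ⟨m, hm⟩ := exists_pow_lt_of_lt_one (sub_pos.2 hxb) (by norm_num : (1 / 2 : ℝ) < 1)
        exact ⟨m, b, hb, by rw [Metric.mem_ball]; linarith⟩)
      (directed_of_isDirected_le fun i j hij => Set.iUnion₂_mono fun b _ =>
        Metric.ball_subset_ball (sub_le_sub_left
          (pow_le_pow_of_le_one (by norm_num) (by norm_num) hij) _))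
    refine ⟨m + 1, fun q hq => ?_⟩
    obtain ⟨x, hx, hd⟩ := Metric.exists_dist_lt_of_hausdorffDist_lt
      (Set.mem_image_of_mem ratPoint (show q ∈ {q | q ∈ C (m + 1)} from hq)) (hC (m + 1)).2
      (fin (m + 1))
    have := hm hx
    simp only [Set.mem_iUnion] at this
    obtain ⟨b, hb, hxb⟩ := this
    rw [Metric.mem_ball] at hxb
    refine ⟨b, hb, (ballTest_iff _ _ _).2 ?_⟩
    have := dist_triangle (ratPoint q) x (ratPoint (b.1, b.2.1))
    rw [pow_succ] at hd ⊢
    linarith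

/-- For a computable compact set `K ⊆ ℂ`, the relation "the finite list `L` of
rational balls covers `K`" is semi-decidable: it is the domain of a partial recursive
function on (codes of) finite lists of rational balls. -/
theorem covering_semiDecidable (K : Set ℂ) (hK : IsCompact K)
    (hKc : ComputableCompactSet K) :
    ∃ F : List (ℚ × ℚ × ℚ) →. Unit, Partrec F ∧
      ∀ L : List (ℚ × ℚ × ℚ), (F L).Dom ↔ K ⊆ ⋃ b ∈ L, ratBall b := by
  obtain ⟨C, hCc, hC⟩ := hKc
  have hinner : Computable fun y : (List (ℚ × ℚ × ℚ) × ℕ) × (ℚ × ℚ) =>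
      y.1.1.any fun c => ballTest y.1.2 y.2 c :=
    computable_any (l := fun y : (List (ℚ × ℚ × ℚ) × ℕ) × (ℚ × ℚ) => y.1.1)
      (p := fun z => ballTest z.1.1.2 z.1.2 z.2) (Computable.fst.comp Computable.fst)
      (computable_ballTest (Computable.snd.comp (Computable.fst.comp Computable.fst))
        (Computable.snd.comp Computable.fst) Computable.snd)
  have htest : Computable fun x : List (ℚ × ℚ × ℚ) × ℕ =>
      (C x.2).all fun q => x.1.any fun c => ballTest x.2 q c :=
    computable_all (l := fun x : List (ℚ × ℚ × ℚ) × ℕ => C x.2)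
      (p := fun y => y.1.1.any fun c => ballTest y.1.2 y.2 c)
      (hCc.comp Computable.snd) hinner
  have hopt : Computable₂ fun (L : List (ℚ × ℚ × ℚ)) (n : ℕ) =>
      bif ((C n).all fun q => L.any fun c => ballTest n q c) then some () else none :=
    Computable.cond htest (Computable.const _) (Computable.const _)
  refine ⟨_, Partrec.rfindOpt hopt, fun L => ?_⟩
  rw [Nat.rfindOpt_dom, ← cover_iff hK hC L]
  refine exists_congr fun n => ?_
  cases hb : ((C n).all fun q => L.any fun c => ballTest n q c) with
  | true =>
    simp only [List.all_eq_true, List.any_eq_true] at hb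
    simp only [cond_true]
    exact ⟨fun _ => hb, fun _ => ⟨(), rfl⟩⟩
  | false =>
    simp only [cond_false, Option.mem_def, reduceCtorEq, exists_false, false_iff]
    intro h
    have : ((C n).all fun q => L.any fun c => ballTest n q c) = true := by
      simp only [List.all_eq_true, List.any_eq_true]
      exact h
    rw [hb] at this
    cases this
end
end
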